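/- arXiv:2105.02536 — 2 statements merged into one kernel-verified Lean document; each statement's English description precedes it below -/
import Mathlib

section
/- Scalar identity underlying the commutation of the two deformed families: fix k ∈ ℤ_{≥0} and λ ∈ ℤ^m, and for μ ∈ ℤ^m with μ_j ≥ max(0, λ_j) for all j and I ⊆ {1,…,r}, define G(x; y) := ∏_{i∈I, j∈I^c} ([y_i−y_j−δ][y_i−y_j+δ−κ])/([y_i−y_j][y_i−y_j−κ]) · ∏_{i,j=1}^m ( [x_i−x_j+δ]_{μ_i−μ_j}/[x_i−x_j+κ; δ]_{μ_i−μ_j} · ([x_i−x_j+κ; δ]_{μ_i} [x_i−x_j+κ; δ]_{μ_i−λ_j})/([x_i−x_j+δ]_{μ_i} [x_i−x_j+δ]_{μ_i−λ_j}) ) · ∏_{i=1}^m ( ∏_{j∈I} ([x_i−y_j+λ_iδ−κ][x_i−y_j+(μ_i−1)δ+κ])/([x_i−y_j+(λ_i−1)δ][x_i−y_j+μ_iδ]) · ∏_{j∈I^c} ([x_i−y_j−δ][x_i−y_j+μ_iδ−κ])/([x_i−y_j−κ][x_i−y_j+(μ_i−1)δ]) ). Then for every (x, y) ∈ ℂ^m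 × ℂ^r at which all bracket values occurring in denominators on either side are nonzero, Σ_{μ_j ≥ max(0,λ_j), I ⊆ {1,…,r}, |μ|+|I| = k} G(x; y) = ∏_{i,j=1}^m ([x_i−x_j+κ; δ]_{λ_i−λ_j}/[x_i−x_j+δ]_{λ_i−λ_j}) · Σ_{μ_j ≥ max(0,λ_j), I ⊆ {1,…,r}, |μ|+|I| = k} G(x̂; ŷ), where x̂_j := −x_j − λ_jδ + κ for 1 ≤ j ≤ m and ŷ_j := −y_j − δ for 1 ≤ j ≤ r. -/
open Finset

/-- Shifted factorial `[x; a]_k` for `k ∈ ℤ`: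
`[x; a]_k = [x][x+a]⋯[x+(k-1)a]` for `k ≥ 0` and `[x; a]_{-k} = 1/[x-ka; a]_k`. -/
noncomputable def sfac (br : ℂ → ℂ) (a x : ℂ) (k : ℤ) : ℂ :=
  if 0 ≤ k then ∏ i ∈ Finset.range k.toNat, br (x + (i : ℂ) * a)
  else (∏ i ∈ Finset.range (-k).toNat, br (x + ((k : ℂ) + (i : ℂ)) * a))⁻¹

/-- The summand `G(x; y)` of the scalar identity underlying the commutation of
the two deformed families. -/
noncomputable def Gterm (br : ℂ → ℂ) (δ κ : ℂ) {m r : ℕ} (lam : Fin m → ℤ)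
    (μ : Fin m → ℕ) (I : Finset (Fin r)) (x : Fin m → ℂ) (y : Fin r → ℂ) : ℂ :=
  (∏ i ∈ I, ∏ j ∈ Iᶜ,
      (br (y i - y j - δ) * br (y i - y j + δ - κ)) / (br (y i - y j) * br (y i - y j - κ)))
    * (∏ i : Fin m, ∏ j : Fin m,
        (sfac br δ (x i - x j + δ) ((μ i : ℤ) - (μ j : ℤ))
            / sfac br δ (x i - x j + κ) ((μ i : ℤ) - (μ j : ℤ)))
          * ((sfac br δ (x i - x j + κ) (μ i : ℤ)
                * sfac br δ (x i - x j + κ) ((μ i : ℤ) - lam j))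
              / (sfac br δ (x i - x j + δ) (μ i : ℤ)
                * sfac br δ (x i - x j + δ) ((μ i : ℤ) - lam j))))
    * ∏ i : Fin m,
        ((∏ j ∈ I,
            (br (x i - y j + (lam i : ℂ) * δ - κ) * br (x i - y j + ((μ i : ℂ) - 1) * δ + κ))
              / (br (x i - y j + ((lam i : ℂ) - 1) * δ) * br (x i - y j + (μ i : ℂ) * δ)))
          * ∏ j ∈ Iᶜ,
            (br (x i - y j - δ) * br (x i - y j + (μ i : ℂ) * δ - κ))
              / (br (x i - y j - κ) * br (x i - y j + ((μ i : ℂ) - 1) * δ)))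

/-- Index set: pairs `(μ, I)` with `μ_j ≥ max(0, λ_j)` and `|μ| + |I| = k`. -/
def GIdx {m : ℕ} (lam : Fin m → ℤ) (r k : ℕ) : Finset ((Fin m → ℕ) × Finset (Fin r)) :=
  ((Fintype.piFinset fun _ : Fin m => Finset.range (k + 1)) ×ˢ
      (Finset.univ : Finset (Finset (Fin r)))).filter
    fun p => (∀ j, lam j ≤ (p.1 j : ℤ)) ∧ (∑ i, p.1 i) + p.2.card = k

/-- Nonvanishing of all bracket values occurring in denominators of `G(x; y)`. -/
def GDenomNZ (br : ℂ → ℂ) (δ κ : ℂ) {m r : ℕ} (lam : Fin m → ℤ)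
    (μ : Fin m → ℕ) (I : Finset (Fin r)) (x : Fin m → ℂ) (y : Fin r → ℂ) : Prop :=
  (∀ i ∈ I, ∀ j ∈ Iᶜ, br (y i - y j) ≠ 0 ∧ br (y i - y j - κ) ≠ 0)
    ∧ (∀ i j : Fin m,
        (if (0 : ℤ) ≤ (μ i : ℤ) - (μ j : ℤ) then
            sfac br δ (x i - x j + κ) ((μ i : ℤ) - (μ j : ℤ)) ≠ 0
          else sfac br δ (x i - x j + δ) ((μ i : ℤ) - (μ j : ℤ)) ≠ 0)
          ∧ sfac br δ (x i - x j + δ) (μ i : ℤ) ≠ 0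
          ∧ (if (0 : ℤ) ≤ (μ i : ℤ) - lam j then
              sfac br δ (x i - x j + δ) ((μ i : ℤ) - lam j) ≠ 0
            else sfac br δ (x i - x j + κ) ((μ i : ℤ) - lam j) ≠ 0))
    ∧ (∀ i : Fin m, ∀ j ∈ I,
        br (x i - y j + ((lam i : ℂ) - 1) * δ) ≠ 0
          ∧ br (x i - y j + (μ i : ℂ) * δ) ≠ 0)
    ∧ (∀ i : Fin m, ∀ j ∈ Iᶜ,
        br (x i - y j - κ) ≠ 0 ∧ br (x i - y j + ((μ i : ℂ) - 1) * δ) ≠ 0)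

open Filter Topology

/-- An entire odd function, not identically zero, satisfying the three-term relation. -/
structure IsBracket (br : ℂ → ℂ) : Prop where
  odd : ∀ z : ℂ, br (-z) = -br z
  entire : Differentiable ℂ br
  ne_zero : br ≠ 0
  three_term : ∀ a b c d : ℂ,
      br (a + b) * br (a - b) * br (c + d) * br (c - d)
        + br (a + d) * br (a - d) * br (b + c) * br (b - c)
        = br (a + c) * br (a - c) * br (b + d) * br (b - d)

instance neBot_cocountable_complex : (cocountable : Filter ℂ).NeBot := by
  rw [neBot_iff]
  intro h
  have : (∅ : Set ℂ) ∈ (cocountable : Filter ℂ) := by rw [h]; exact mem_bot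
  rw [mem_cocountable, Set.compl_empty] at this
  exact not_countable_complex this

namespace IsBracket

variable {br : ℂ → ℂ}

theorem map_zero (h : IsBracket br) : br 0 = 0 := by
  have := h.odd 0
  rw [neg_zero] at this
  exact self_eq_neg.mp this

theorem sub_comm (h : IsBracket br) (a b : ℂ) : br (a - b) = -br (b - a) := by
  rw [← h.odd]; ring_nf

theorem eventually_punctured_ne_zero (h : IsBracket br) (c z : ℂ) :
    ∀ᶠ t in 𝓝[≠] c, br (t - z) ≠ 0 := by
  have ha : AnalyticOnNhd ℂ (fun t => br (t - z)) Set.univ := fun x _ =>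
    (Differentiable.analyticAt (h.entire.comp (differentiable_id.sub_const z)) x)
  rcases (ha c trivial).eventually_eq_zero_or_eventually_ne_zero with h0 | h0
  · exfalso
    apply h.ne_zero
    have := ha.eqOn_zero_of_preconnected_of_eventuallyEq_zero isPreconnected_univ
      (Set.mem_univ c) h0
    funext w
    simpa using this (Set.mem_univ (w + z))
  · exact h0

theorem countable_zeros (h : IsBracket br) : {z | br z = 0}.Countable := by
  have : DiscreteTopology {z | br z = 0} := by
    refine discreteTopology_subtype_iff.mpr fun z _ => ?_
    rw [← empty_mem_iff_bot, mem_inf_principal]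
    filter_upwards [h.eventually_punctured_ne_zero z 0] with t ht h0
    exact ht (by simpa using h0)
  exact Set.countable_coe_iff.mp countable_of_Lindelof_of_discrete

theorem eventually_cocountable (h : IsBracket br) {α : ℂ} (hα : α ≠ 0) (β : ℂ) :
    ∀ᶠ s in (cocountable : Filter ℂ), br (α * s + β) ≠ 0 := by
  have : {s | br (α * s + β) ≠ 0}ᶜ = (fun s => α * s + β) ⁻¹' {z | br z = 0} := by
    ext s; simp
  change _ ∈ _
  rw [mem_cocountable, this]
  apply h.countable_zeros.preimage_of_injOn
  intro a _ b _ hab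
  simpa [hα] using hab

theorem continuous_sub (h : IsBracket br) (c : ℂ) : Continuous fun t => br (t - c) :=
  h.entire.continuous.comp (by fun_prop)

end IsBracket

/-- The product `∏_{c ∈ s} [t - c]`. -/
def thetaProd (br : ℂ → ℂ) (s : Multiset ℂ) : ℂ → ℂ := fun t => (s.map fun c => br (t - c)).prod

/-- The span of the products of `n` brackets `[t - c]` whose zeros `c` sum to `T`. -/
def Theta (br : ℂ → ℂ) (n : ℕ) (T : ℂ) : Submodule ℂ (ℂ → ℂ) :=
  Submodule.span ℂ {g | ∃ s : Multiset ℂ, s.card = n ∧ s.sum = T ∧ g = thetaProd br s}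

section Theta

variable {br : ℂ → ℂ}

theorem thetaProd_add (s t : Multiset ℂ) :
    thetaProd br (s + t) = thetaProd br s * thetaProd br t := by
  funext x; simp [thetaProd]

theorem thetaProd_cons (c : ℂ) (s : Multiset ℂ) :
    thetaProd br (c ::ₘ s) = (fun t => br (t - c)) * thetaProd br s := by
  funext x; simp [thetaProd]

@[simp] theorem thetaProd_zero : thetaProd br 0 = 1 := by
  funext x; simp [thetaProd]

theorem thetaProd_singleton (c : ℂ) : thetaProd br {c} = fun t => br (t - c) := by
  funext x; simp [thetaProd]

theorem thetaProd_mem (s : Multiset ℂ) : thetaProd br s ∈ Theta br s.card s.sum :=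
  Submodule.subset_span ⟨s, rfl, rfl, rfl⟩

theorem thetaProd_mem_of_eq {s : Multiset ℂ} {n : ℕ} {T : ℂ} (hn : s.card = n) (hT : s.sum = T) :
    thetaProd br s ∈ Theta br n T := by subst hn hT; exact thetaProd_mem s

theorem Theta.mul {n m : ℕ} {T S : ℂ} {p q : ℂ → ℂ} (hp : p ∈ Theta br n T)
    (hq : q ∈ Theta br m S) : p * q ∈ Theta br (n + m) (T + S) := by
  induction hp using Submodule.span_induction with
  | mem x hx =>
    obtain ⟨s, rfl, rfl, rfl⟩ := hx
    induction hq using Submodule.span_induction with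
    | mem y hy =>
      obtain ⟨t, rfl, rfl, rfl⟩ := hy
      rw [← thetaProd_add]
      exact thetaProd_mem_of_eq (by simp) (by simp)
    | zero => simp
    | add y z _ _ hy hz => rw [mul_add]; exact add_mem hy hz
    | smul a y _ hy => rw [mul_smul_comm]; exact Submodule.smul_mem _ _ hy
  | zero => simp
  | add y z _ _ hy hz => rw [add_mul]; exact add_mem hy hz
  | smul a y _ hy => rw [smul_mul_assoc]; exact Submodule.smul_mem _ _ hy

theorem Theta.congr {n m : ℕ} {T S : ℂ} {p : ℂ → ℂ} (hp : p ∈ Theta br n T) (hn : n = m)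
    (hT : T = S) : p ∈ Theta br m S := by subst hn hT; exact hp

theorem IsBracket.continuous_theta (h : IsBracket br) {n : ℕ} {T : ℂ} {p : ℂ → ℂ}
    (hp : p ∈ Theta br n T) : Continuous p := by
  induction hp using Submodule.span_induction with
  | mem x hx =>
    obtain ⟨s, rfl, rfl, rfl⟩ := hx
    induction s using Multiset.induction_on with
    | empty => simpa using continuous_one
    | cons a s ih => rw [thetaProd_cons]; exact (h.continuous_sub a).mul ih
  | zero => exact continuous_zero
  | add y z _ _ hy hz => exact hy.add hz
  | smul a y _ hy => exact hy.const_smul a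

theorem IsBracket.exchange (h : IsBracket br) (t P c₁ c₂ d : ℂ) :
    br (t - c₁) * br (t - c₂) * (br (P - d) * br (P - (c₁ + c₂ - d)))
      = br (t - d) * br (t - (c₁ + c₂ - d)) * (br (P - c₁) * br (P - c₂))
        + br (d - c₂) * br (c₁ - d) * (br (t - P) * br (t - (c₁ + c₂ - P))) := by
  have := h.three_term (t - (c₁ + c₂) / 2) (P - (c₁ + c₂) / 2) (c₁ - (c₁ + c₂) / 2)
    (d - (c₁ + c₂) / 2)
  ring_nf at this ⊢
  linear_combination -this

theorem IsBracket.thetaProd_reduce (h : IsBracket br) (P : ℂ) (n : ℕ) :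
    ∀ s : Multiset ℂ, s.card = n + 1 → ∀ᶠ d in (cocountable : Filter ℂ),
      ∃ a : ℂ, ∃ r ∈ Theta br n (s.sum - P),
        thetaProd br s = a • thetaProd br ((s.sum - n * d) ::ₘ Multiset.replicate n d)
          + (fun t => br (t - P)) * r := by
  induction n with
  | zero =>
    intro s hs
    obtain ⟨c, rfl⟩ := Multiset.card_eq_one.mp hs
    refine Eventually.of_forall fun d => ⟨1, 0, zero_mem _, ?_⟩
    simp
  | succ n ih =>
    intro s hs
    obtain ⟨c, s', hs'⟩ := Multiset.card_pos_iff_exists_mem.mp (by omega : 0 < s.card) |>.imp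
      fun c hc => Multiset.exists_cons_of_mem hc
    subst hs'
    have hcard : s'.card = n + 1 := by simpa using hs
    have hn : (-(n + 1) : ℂ) ≠ 0 := neg_ne_zero.mpr (Nat.cast_add_one_ne_zero n)
    filter_upwards [ih s' hcard, h.eventually_cocountable (α := -1) (by norm_num) P,
      h.eventually_cocountable (α := -(-(n + 1) : ℂ)) (neg_ne_zero.mpr hn) (P - (c + s'.sum))]
      with d hd h1 h2
    obtain ⟨a, r, hr, e⟩ := hd
    set u := s'.sum - n * d with hu
    have h1' : br (P - d) ≠ 0 := by convert h1 using 2; ring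
    have h2' : br (P - (c + u - d)) ≠ 0 := by convert h2 using 2; rw [hu]; ring
    have hD : br (P - d) * br (P - (c + u - d)) ≠ 0 := mul_ne_zero h1' h2'
    set D := br (P - d) * br (P - (c + u - d))
    refine ⟨a * ((br (P - c) * br (P - u)) / D),
      (a * (br (d - u) * br (c - d) / D)) •
        thetaProd br ((c + u - P) ::ₘ Multiset.replicate n d) + (fun t => br (t - c)) * r,
      ?_, ?_⟩
    · refine add_mem (Submodule.smul_mem _ _ (thetaProd_mem_of_eq (by simp) ?_)) ?_
      · simp [hu]; ring
      · rw [← thetaProd_singleton]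
        refine Theta.congr (Theta.mul (thetaProd_mem _) hr) (by simp; ring) ?_
        simp; ring
    · rw [thetaProd_cons, e]
      have e1 : (c ::ₘ s').sum - (n + 1 : ℕ) * d = c + u - d := by
        simp [hu]; ring
      rw [e1]
      funext t
      have := h.exchange t P c u d
      simp only [thetaProd_cons, Multiset.replicate_succ, Pi.mul_apply, Pi.add_apply,
        Pi.smul_apply, smul_eq_mul]
      field_simp
      linear_combination a * (thetaProd br (Multiset.replicate n d) t) * this

theorem IsBracket.theta_factor (h : IsBracket br) {n : ℕ} {T P : ℂ} {p : ℂ → ℂ}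
    (hp : p ∈ Theta br (n + 2) T) (hP : p P = 0) :
    ∃ r ∈ Theta br (n + 1) (T - P), p = (fun t => br (t - P)) * r := by
  have key : ∀ᶠ d in (cocountable : Filter ℂ), ∃ a : ℂ, ∃ r ∈ Theta br (n + 1) (T - P),
      p = a • thetaProd br ((T - (n + 1 : ℕ) * d) ::ₘ Multiset.replicate (n + 1) d)
        + (fun t => br (t - P)) * r := by
    clear hP
    induction hp using Submodule.span_induction with
    | mem x hx =>
      obtain ⟨s, hs, rfl, rfl⟩ := hx
      exact h.thetaProd_reduce P (n + 1) s hs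
    | zero => exact Eventually.of_forall fun d => ⟨0, 0, zero_mem _, by simp⟩
    | add y z _ _ hy hz =>
      filter_upwards [hy, hz] with d ⟨a, r, hr, e⟩ ⟨a', r', hr', e'⟩
      exact ⟨a + a', r + r', add_mem hr hr', by
        rw [e, e', add_smul, mul_add]; abel⟩
    | smul b y _ hy =>
      filter_upwards [hy] with d ⟨a, r, hr, e⟩
      refine ⟨b * a, b • r, Submodule.smul_mem _ _ hr, ?_⟩
      rw [e, smul_add, mul_smul, mul_smul_comm]
  have hn : ((n + 1 : ℕ) : ℂ) ≠ 0 := Nat.cast_ne_zero.mpr (Nat.succ_ne_zero n)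
  obtain ⟨d, ⟨a, r, hr, e⟩, h1, h2⟩ := (key.and ((h.eventually_cocountable (α := -1)
    (by norm_num) P).and (h.eventually_cocountable hn (P - T)))).exists
  refine ⟨r, hr, ?_⟩
  have ha : a = 0 := by
    have := congrFun e P
    rw [hP] at this
    simp only [thetaProd, Pi.add_apply, Pi.smul_apply, Pi.mul_apply, sub_self, h.map_zero,
      Multiset.map_cons, Multiset.prod_cons, Multiset.map_replicate, Multiset.prod_replicate,
      zero_mul, add_zero, smul_eq_mul] at this
    rw [eq_comm, mul_eq_zero, mul_eq_zero] at this
    rcases this with h0 | h0 | h0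
    · exact h0
    · exact absurd (by convert h0 using 2; ring) h2
    · exact absurd (by convert eq_zero_of_pow_eq_zero h0 using 2; ring) h1
  rw [e, ha, zero_smul, zero_add]

theorem theta_one {T : ℂ} {p : ℂ → ℂ} (hp : p ∈ Theta br 1 T) :
    ∃ a : ℂ, p = a • fun t => br (t - T) := by
  induction hp using Submodule.span_induction with
  | mem x hx =>
    obtain ⟨s, hs, rfl, rfl⟩ := hx
    obtain ⟨c, rfl⟩ := Multiset.card_eq_one.mp hs
    exact ⟨1, by simp [thetaProd_singleton]⟩
  | zero => exact ⟨0, by simp⟩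
  | add y z _ _ hy hz =>
    obtain ⟨a, rfl⟩ := hy
    obtain ⟨b, rfl⟩ := hz
    exact ⟨a + b, by module⟩
  | smul b y _ hy =>
    obtain ⟨a, rfl⟩ := hy
    exact ⟨b * a, by module⟩

theorem theta_zero {T : ℂ} {p : ℂ → ℂ} (hp : p ∈ Theta br 0 T) : ∃ a : ℂ, p = fun _ => a := by
  induction hp using Submodule.span_induction with
  | mem x hx =>
    obtain ⟨s, hs, rfl, rfl⟩ := hx
    rw [Multiset.card_eq_zero.mp hs]
    exact ⟨1, by simp; rfl⟩
  | zero => exact ⟨0, rfl⟩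
  | add y z _ _ hy hz =>
    obtain ⟨a, rfl⟩ := hy
    obtain ⟨b, rfl⟩ := hz
    exact ⟨a + b, rfl⟩
  | smul b y _ hy =>
    obtain ⟨a, rfl⟩ := hy
    exact ⟨b * a, rfl⟩

/-- An element of `Theta br (n + 1) T` vanishing at `n + 1` distinct points is zero, unless the
points sum to `T` modulo zeros of the bracket. -/
theorem IsBracket.theta_eq_zero (h : IsBracket br) (P : ℕ → ℂ) (n : ℕ) {T : ℂ} {p : ℂ → ℂ}
    (hp : p ∈ Theta br (n + 1) T) (hP : ∀ i ≤ n, p (P i) = 0)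
    (hne : ∀ i j, i < j → br (P i - P j) ≠ 0)
    (hT : br (T - ∑ i ∈ Finset.range (n + 1), P i) ≠ 0) : p = 0 := by
  induction n generalizing T p with
  | zero =>
    obtain ⟨a, rfl⟩ := theta_one hp
    have := hP 0 le_rfl
    simp only [Pi.smul_apply, smul_eq_mul, mul_eq_zero] at this
    rcases this with rfl | h0
    · simp
    · exact absurd (by rw [h.sub_comm, Finset.sum_range_one, h0, neg_zero]) hT
  | succ n ih =>
    obtain ⟨r, hr, rfl⟩ := h.theta_factor hp (hP (n + 1) le_rfl)
    rw [ih hr, mul_zero]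
    · intro i hi
      have := hP i (by omega)
      simp only [Pi.mul_apply, mul_eq_zero] at this
      exact this.resolve_left (hne i (n + 1) (by omega))
    · convert hT using 2
      rw [Finset.sum_range_succ _ (n + 1)]; ring

end Theta

/-- `g` is a quotient `p / q` with `q` a product of brackets `[t - c]`, `c ∈ A`, and `p` a theta
function of the same degree as `q` whose zeros have a sum exceeding that of the zeros of `q`
by `T`. -/
def ThetaQuot (br : ℂ → ℂ) (A : Set ℂ) (T : ℂ) (g : ℂ → ℂ) : Prop :=
  ∃ q : Multiset ℂ, (∀ c ∈ q, c ∈ A) ∧ ∃ p ∈ Theta br q.card (q.sum + T),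
    ∀ t, thetaProd br q t ≠ 0 → g t * thetaProd br q t = p t

section ThetaQuot

variable {br : ℂ → ℂ} {A : Set ℂ}

theorem thetaProd_ne_zero {q : Multiset ℂ} {t : ℂ} (h : ∀ c ∈ q, br (t - c) ≠ 0) :
    thetaProd br q t ≠ 0 := by
  simp only [thetaProd, ne_eq, Multiset.prod_eq_zero_iff, Multiset.mem_map, not_exists, not_and]
  exact h

theorem ThetaQuot.add {T : ℂ} {f g : ℂ → ℂ} (hf : ThetaQuot br A T f) (hg : ThetaQuot br A T g) :
    ThetaQuot br A T (fun t => f t + g t) := by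
  obtain ⟨q, hq, p, hp, e⟩ := hf
  obtain ⟨q', hq', p', hp', e'⟩ := hg
  refine ⟨q + q', fun c hc => (Multiset.mem_add.mp hc).elim (hq c) (hq' c),
    p * thetaProd br q' + thetaProd br q * p', add_mem ?_ ?_, ?_⟩
  · exact Theta.congr (Theta.mul hp (thetaProd_mem _)) (by simp) (by simp; ring)
  · exact Theta.congr (Theta.mul (thetaProd_mem _) hp') (by simp) (by simp; ring)
  · intro t ht
    rw [thetaProd_add, Pi.mul_apply] at ht ⊢
    simp only [Pi.add_apply, Pi.mul_apply, ← e t (left_ne_zero_of_mul ht),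
      ← e' t (right_ne_zero_of_mul ht)]
    ring

theorem ThetaQuot.mul {S T : ℂ} {f g : ℂ → ℂ} (hf : ThetaQuot br A S f)
    (hg : ThetaQuot br A T g) : ThetaQuot br A (S + T) (fun t => f t * g t) := by
  obtain ⟨q, hq, p, hp, e⟩ := hf
  obtain ⟨q', hq', p', hp', e'⟩ := hg
  refine ⟨q + q', fun c hc => (Multiset.mem_add.mp hc).elim (hq c) (hq' c), p * p', ?_, ?_⟩
  · exact Theta.congr (Theta.mul hp hp') (by simp) (by simp; ring)
  · intro t ht
    rw [thetaProd_add, Pi.mul_apply] at ht ⊢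
    simp only [Pi.mul_apply, ← e t (left_ne_zero_of_mul ht),
      ← e' t (right_ne_zero_of_mul ht)]
    ring

theorem ThetaQuot.zero (T : ℂ) : ThetaQuot br A T (fun _ => 0) :=
  ⟨0, by simp, 0, zero_mem _, by simp⟩

theorem ThetaQuot.const (a : ℂ) : ThetaQuot br A 0 (fun _ => a) := by
  refine ⟨0, by simp, a • thetaProd br 0, Submodule.smul_mem _ _ ?_, by simp⟩
  exact thetaProd_mem_of_eq (by simp) (by simp)

theorem ThetaQuot.congr {S T : ℂ} {f g : ℂ → ℂ} (hf : ThetaQuot br A S f) (hT : S = T)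
    (hg : ∀ t, g t = f t) : ThetaQuot br A T g := by
  obtain rfl : g = f := funext hg
  subst hT
  exact hf

theorem ThetaQuot.const_mul {T : ℂ} {f : ℂ → ℂ} (a : ℂ) (hf : ThetaQuot br A T f) :
    ThetaQuot br A T (fun t => a * f t) :=
  ((ThetaQuot.const a).mul hf).congr (zero_add T) fun _ => rfl

theorem ThetaQuot.sub {T : ℂ} {f g : ℂ → ℂ} (hf : ThetaQuot br A T f) (hg : ThetaQuot br A T g) :
    ThetaQuot br A T (fun t => f t - g t) :=
  (hf.add (hg.const_mul (-1))).congr rfl fun _ => by ring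

theorem ThetaQuot.sum {ι : Type*} {T : ℂ} {f : ι → ℂ → ℂ} (s : Finset ι)
    (hf : ∀ i ∈ s, ThetaQuot br A T (f i)) : ThetaQuot br A T (fun t => ∑ i ∈ s, f i t) := by
  classical
  induction s using Finset.induction_on with
  | empty => exact (ThetaQuot.zero T).congr rfl fun t => by simp
  | insert a s ha ih =>
    refine ((hf a (by simp)).add (ih fun i hi => hf i (by simp [hi]))).congr rfl fun t => ?_
    rw [Finset.sum_insert ha]

theorem ThetaQuot.prod {ι : Type*} {T : ι → ℂ} {f : ι → ℂ → ℂ} (s : Finset ι)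
    (hf : ∀ i ∈ s, ThetaQuot br A (T i) (f i)) :
    ThetaQuot br A (∑ i ∈ s, T i) (fun t => ∏ i ∈ s, f i t) := by
  classical
  induction s using Finset.induction_on with
  | empty => exact (ThetaQuot.const 1).congr (by simp) fun t => by simp
  | insert a s ha ih =>
    refine ((hf a (by simp)).mul (ih fun i hi => hf i (by simp [hi]))).congr ?_ fun t => ?_
    · rw [Finset.sum_insert ha]
    · rw [Finset.prod_insert ha]

theorem ThetaQuot.div {c c' : ℂ} (hc : c' ∈ A) :
    ThetaQuot br A (c - c') (fun t => br (t - c) / br (t - c')) := by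
  refine ⟨{c'}, by simpa using hc, thetaProd br {c},
    thetaProd_mem_of_eq (by simp) (by simp), fun t ht => ?_⟩
  simp only [thetaProd_singleton] at ht ⊢
  field_simp

theorem IsBracket.eventually_thetaProd_ne_zero (h : IsBracket br) (q : Multiset ℂ) (c : ℂ) :
    ∀ᶠ t in 𝓝[≠] c, thetaProd br q t ≠ 0 := by
  induction q using Multiset.induction_on with
  | empty => simp
  | cons a s ih =>
    filter_upwards [ih, h.eventually_punctured_ne_zero c a] with t h1 h2
    rw [thetaProd_cons]
    exact mul_ne_zero h2 h1

/-- A theta quotient of degree zero without poles is constant. -/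
theorem IsBracket.thetaQuot_const (h : IsBracket br) {g : ℂ → ℂ} (hg : ThetaQuot br A 0 g)
    (hlim : ∀ c ∈ A, Tendsto (fun t => br (t - c) * g t) (𝓝[≠] c) (𝓝 0)) :
    ∃ C, ∀ t, (∀ c ∈ A, br (t - c) ≠ 0) → g t = C := by
  obtain ⟨q₀, hq₀, p₀, hp₀, e₀⟩ := hg
  suffices H : ∀ n : ℕ, ∀ q : Multiset ℂ, q.card = n → (∀ c ∈ q, c ∈ q₀) →
      ∀ p ∈ Theta br q.card q.sum,
      (∀ t, thetaProd br q₀ t ≠ 0 → g t * thetaProd br q t = p t) →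
      ∃ C, ∀ t, thetaProd br q₀ t ≠ 0 → g t = C by
    obtain ⟨C, hC⟩ := H _ q₀ rfl (fun _ => id) p₀ (by simpa using hp₀) e₀
    exact ⟨C, fun t ht => hC t (thetaProd_ne_zero fun c hc => ht c (hq₀ c hc))⟩
  intro n
  induction n with
  | zero =>
    intro q hq _ p hp e
    rw [hq] at hp
    obtain ⟨a, rfl⟩ := theta_zero hp
    refine ⟨a, fun t ht => ?_⟩
    simpa [Multiset.card_eq_zero.mp hq] using e t ht
  | succ n ih =>
    intro q hq hsub p hp e
    obtain ⟨c, q', rfl⟩ := Multiset.card_pos_iff_exists_mem.mp (by omega : 0 < q.card) |>.imp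
      fun c hc => Multiset.exists_cons_of_mem hc
    have hq' : q'.card = n := by simpa using hq
    have hc : c ∈ q₀ := hsub c (by simp)
    have hne : ∀ t, thetaProd br q₀ t ≠ 0 → br (t - c) ≠ 0 := by
      intro t ht h0
      apply ht
      obtain ⟨r, rfl⟩ := Multiset.exists_cons_of_mem hc
      rw [thetaProd_cons, Pi.mul_apply, h0, zero_mul]
    rcases n with _ | n
    · rw [hq] at hp
      obtain rfl := Multiset.card_eq_zero.mp hq'
      obtain ⟨a, rfl⟩ := theta_one hp
      refine ⟨a, fun t ht => ?_⟩
      have := e t ht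
      simp only [thetaProd_cons, thetaProd_zero, mul_one, Multiset.sum_cons, Multiset.sum_zero,
        add_zero, Pi.smul_apply, smul_eq_mul] at this
      exact mul_right_cancel₀ (hne t ht) this
    · have hpc : p c = 0 := by
        have h1 : Tendsto p (𝓝[≠] c) (𝓝 (p c)) :=
          ((h.continuous_theta hp).tendsto c).mono_left nhdsWithin_le_nhds
        have h2 : Tendsto p (𝓝[≠] c) (𝓝 (0 * thetaProd br q' c)) := by
          refine ((hlim c (hq₀ c hc)).mul ((((h.continuous_theta
            (thetaProd_mem q')).tendsto c).mono_left nhdsWithin_le_nhds))).congr' ?_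
          filter_upwards [h.eventually_thetaProd_ne_zero q₀ c] with t ht
          rw [← e t ht, thetaProd_cons, Pi.mul_apply]
          ring
        rw [zero_mul] at h2
        exact tendsto_nhds_unique h1 h2
      rw [hq] at hp
      obtain ⟨r, hr, rfl⟩ := h.theta_factor hp hpc
      refine ih q' hq' (fun d hd => hsub d (by simp [hd])) r
        (Theta.congr hr hq'.symm (by simp)) fun t ht => ?_
      have := e t ht
      rw [thetaProd_cons, Pi.mul_apply, Pi.mul_apply] at this
      refine mul_left_cancel₀ (hne t ht) ?_
      rw [← this]
      ring

/-- A theta quotient of degree zero vanishing at all points `t₀ + n δ` vanishes wherever its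
denominator does not. -/
theorem IsBracket.thetaQuot_eq_zero (h : IsBracket br) {δ : ℂ}
    (hδ : ∀ n : ℕ, 1 ≤ n → br ((n : ℂ) * δ) ≠ 0) {g : ℂ → ℂ} {T t t₀ : ℂ}
    (hg : ThetaQuot br {c | br (t - c) ≠ 0} T g) (h0 : ∀ n : ℕ, g (t₀ + n * δ) = 0) :
    g t = 0 := by
  obtain ⟨q, hq, p, hp, e⟩ := hg
  have hqt : thetaProd br q t ≠ 0 := thetaProd_ne_zero hq
  set N := q.card + q.card with hN
  obtain ⟨u, hu₁, hu₂⟩ := ((h.eventually_cocountable one_ne_zero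
      (q.sum + T + q.sum - ∑ i ∈ Finset.range (N + 1), (t₀ + i * δ))).and
    (h.eventually_cocountable (α := -1) (by norm_num) t)).exists
  have hmem : p * thetaProd br q * thetaProd br {u} ∈ Theta br (N + 1) (q.sum + T + q.sum + u) :=
    Theta.congr (Theta.mul (Theta.mul hp (thetaProd_mem q)) (thetaProd_mem {u})) (by simp [hN])
      (by simp)
  have hzero := h.theta_eq_zero (fun n => t₀ + n * δ) N hmem (fun n _ => ?_) (fun i j hij => ?_) ?_
  · have := congrFun hzero t
    simp only [Pi.mul_apply, Pi.zero_apply, thetaProd_singleton, mul_eq_zero, hqt, or_false] at this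
    rcases this with h1 | h1
    · have h2 := e t hqt
      rw [h1] at h2
      exact (mul_eq_zero.mp h2).resolve_right hqt
    · exact absurd (by rw [← h1]; ring_nf) hu₂
  · by_cases hn : thetaProd br q (t₀ + n * δ) = 0
    · simp [hn]
    · simp [← e _ hn, h0 n]
  · have := hδ (j - i) (by omega)
    rw [Nat.cast_sub hij.le] at this
    rw [show t₀ + (i : ℂ) * δ - (t₀ + (j : ℂ) * δ) = -(((j : ℂ) - i) * δ) by ring, h.odd]
    exact neg_ne_zero.mpr this
  · convert hu₁ using 2
    ring

end ThetaQuot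

/-- The weighted sum over subsets `I ⊆ S` of the products of `φ i j` over `i ∈ I`, `j ∈ S \ I`. -/
def weightedSubsetSum {α : Type*} [DecidableEq α] (S : Finset α) (w : ℕ → ℂ) (φ : α → α → ℂ) : ℂ :=
  ∑ I ∈ S.powerset, w I.card * ∏ i ∈ I, ∏ j ∈ S \ I, φ i j

/-- The contribution to `weightedSubsetSum` of the subsets containing `a` but not `b`, with the factor
`φ a b` removed. -/
def crossSum {α : Type*} [DecidableEq α] (S : Finset α) (w : ℕ → ℂ) (φ : α → α → ℂ) (a b : α) :
    ℂ :=
  ∑ I ∈ S.powerset, w (I.card + 1) *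
    ((∏ i ∈ I, φ i b) * (∏ j ∈ S \ I, φ a j) * ∏ i ∈ I, ∏ j ∈ S \ I, φ i j)

/-- The contribution to `weightedSubsetSum` of the subsets containing both or neither of `a` and `b`. -/
def sameSum {α : Type*} [DecidableEq α] (S : Finset α) (w : ℕ → ℂ) (φ : α → α → ℂ) (a b : α) :
    ℂ :=
  ∑ I ∈ S.powerset, (w I.card * ∏ i ∈ I, φ i a * φ i b)
      * (∏ i ∈ I, ∏ j ∈ S \ I, φ i j)
    + ∑ I ∈ S.powerset, (w (I.card + 2) * ∏ j ∈ S \ I, φ a j * φ b j)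
      * (∏ i ∈ I, ∏ j ∈ S \ I, φ i j)

section weightedSubsetSum

variable {α : Type*} [DecidableEq α] {S : Finset α} {w : ℕ → ℂ} {a b : α}

theorem weightedSubsetSum_congr {φ ψ : α → α → ℂ} (h : ∀ i ∈ S, ∀ j ∈ S, φ i j = ψ i j) :
    weightedSubsetSum S w φ = weightedSubsetSum S w ψ := by
  refine Finset.sum_congr rfl fun I hI => ?_
  rw [Finset.mem_powerset] at hI
  congr 1
  refine Finset.prod_congr rfl fun i hi => Finset.prod_congr rfl fun j hj => ?_
  exact h i (hI hi) j (Finset.mem_sdiff.mp hj).1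

theorem weightedSubsetSum_insert_insert (ha : a ∉ S) (hb : b ∉ S) (hab : a ≠ b) (φ : α → α → ℂ) :
    weightedSubsetSum (insert a (insert b S)) w φ
      = sameSum S w φ a b + φ a b * crossSum S w φ a b + φ b a * crossSum S w φ b a := by
  have ha' : a ∉ insert b S := by simp [ha, hab]
  rw [weightedSubsetSum, Finset.sum_powerset_insert ha', Finset.sum_powerset_insert hb,
    Finset.sum_powerset_insert hb]
  rw [sameSum, crossSum, crossSum, Finset.mul_sum, Finset.mul_sum]
  simp only [← Finset.sum_add_distrib]
  refine Finset.sum_congr rfl fun I hI => ?_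
  rw [Finset.mem_powerset] at hI
  have haI : a ∉ I := fun h => ha (hI h)
  have hbI : b ∉ I := fun h => hb (hI h)
  have haI' : a ∉ insert b I := by simp [haI, hab]
  have e0 : insert a (insert b S) \ I = insert a (insert b (S \ I)) := by grind
  have e1 : insert a (insert b S) \ insert b I = insert a (S \ I) := by grind
  have e2 : insert a (insert b S) \ insert a I = insert b (S \ I) := by grind
  have e3 : insert a (insert b S) \ insert a (insert b I) = S \ I := by grind
  have hb3 : b ∉ S \ I := by simp [hb]
  have ha3 : a ∉ S \ I := by simp [ha]
  have ha4 : a ∉ insert b (S \ I) := by simp [ha, hab]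
  rw [e0, e1, e2, e3]
  simp only [Finset.prod_insert ha4, Finset.prod_insert hb3, Finset.prod_insert ha3,
    Finset.prod_insert haI', Finset.prod_insert hbI, Finset.prod_insert haI,
    Finset.card_insert_of_notMem haI', Finset.card_insert_of_notMem hbI,
    Finset.card_insert_of_notMem haI, Finset.prod_mul_distrib]
  ring

theorem crossSum_eq_mul {φ : α → α → ℂ} (h : ∀ j ∈ S, φ a j = φ j b) :
    crossSum S w φ a b = (∏ i ∈ S, φ i b) * weightedSubsetSum S (fun n => w (n + 1)) φ := by
  rw [crossSum, weightedSubsetSum, Finset.mul_sum]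
  refine Finset.sum_congr rfl fun I hI => ?_
  rw [Finset.mem_powerset] at hI
  rw [Finset.prod_congr rfl fun j hj => h j (Finset.mem_sdiff.mp hj).1,
    ← Finset.prod_sdiff hI]
  ring

theorem tendsto_mul_weightedSubsetSum (ha : a ∉ S) (hb : b ∉ S) (hab : a ≠ b) {φ : ℂ → α → α → ℂ}
    {c r r' : ℂ} {s : ℂ → ℂ}
    (hφ : ∀ i ∈ S, ContinuousAt (fun t => φ t i a) c ∧ ContinuousAt (fun t => φ t a i) c
      ∧ ContinuousAt (fun t => φ t i b) c ∧ ContinuousAt (fun t => φ t b i) c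
      ∧ ∀ j ∈ S, ContinuousAt (fun t => φ t i j) c)
    (hs : Tendsto s (𝓝[≠] c) (𝓝 0))
    (hr : Tendsto (fun t => s t * φ t a b) (𝓝[≠] c) (𝓝 r))
    (hr' : Tendsto (fun t => s t * φ t b a) (𝓝[≠] c) (𝓝 r')) :
    Tendsto (fun t => s t * weightedSubsetSum (insert a (insert b S)) w (φ t)) (𝓝[≠] c)
      (𝓝 (r * crossSum S w (φ c) a b + r' * crossSum S w (φ c) b a)) := by
  have hE : ∀ I ∈ S.powerset, ContinuousAt (fun t => ∏ i ∈ I, ∏ j ∈ S \ I, φ t i j) c := by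
    intro I hI
    rw [Finset.mem_powerset] at hI
    exact tendsto_finsetProd _ fun i hi => tendsto_finsetProd _ fun j hj =>
      (hφ i (hI hi)).2.2.2.2 j (Finset.mem_sdiff.mp hj).1
  have h0 : ContinuousAt (fun t => sameSum S w (φ t) a b) c := by
    refine ContinuousAt.add (tendsto_finsetSum _ fun I hI => ?_)
      (tendsto_finsetSum _ fun I hI => ?_)
    all_goals
      refine Tendsto.mul (tendsto_const_nhds.mul (tendsto_finsetProd _ fun i hi => ?_)) (hE I hI)
      rw [Finset.mem_powerset] at hI
    · exact (hφ i (hI hi)).1.mul (hφ i (hI hi)).2.2.1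
    · have := hφ i (Finset.mem_sdiff.mp hi).1
      exact this.2.1.mul this.2.2.2.1
  have h1 : ContinuousAt (fun t => crossSum S w (φ t) a b) c := by
    refine tendsto_finsetSum _ fun I hI => tendsto_const_nhds.mul (Tendsto.mul (Tendsto.mul
      (tendsto_finsetProd _ fun i hi => ?_) (tendsto_finsetProd _ fun i hi => ?_)) (hE I hI))
    · exact (hφ i (Finset.mem_powerset.mp hI hi)).2.2.1
    · exact (hφ i (Finset.mem_sdiff.mp hi).1).2.1
  have h2 : ContinuousAt (fun t => crossSum S w (φ t) b a) c := by
    refine tendsto_finsetSum _ fun I hI => tendsto_const_nhds.mul (Tendsto.mul (Tendsto.mul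
      (tendsto_finsetProd _ fun i hi => ?_) (tendsto_finsetProd _ fun i hi => ?_)) (hE I hI))
    · exact (hφ i (Finset.mem_powerset.mp hI hi)).1
    · exact (hφ i (Finset.mem_sdiff.mp hi).1).2.2.2.1
  have hle : 𝓝[≠] c ≤ 𝓝 c := nhdsWithin_le_nhds
  have := ((hs.mul (h0.mono_left hle)).add (hr.mul (h1.mono_left hle))).add
    (hr'.mul (h2.mono_left hle))
  rw [zero_mul, zero_add] at this
  refine this.congr fun t => ?_
  rw [weightedSubsetSum_insert_insert ha hb hab]
  ring

end weightedSubsetSum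

/-- The pair weight `[u-δ][u+δ-κ] / ([u][u-κ])`. -/
noncomputable def pairWeight (br : ℂ → ℂ) (δ κ u : ℂ) : ℂ :=
  br (u - δ) * br (u + δ - κ) / (br u * br (u - κ))

section Ruijsenaars

variable {br : ℂ → ℂ} {δ κ : ℂ}

theorem IsBracket.pairWeight_neg (h : IsBracket br) (u : ℂ) :
    pairWeight br δ κ (-u) = br (u + δ) * br (u - δ + κ) / (br u * br (u + κ)) := by
  unfold pairWeight
  rw [show -u - δ = -(u + δ) by ring, show -u + δ - κ = -(u - δ + κ) by ring,
    show -u - κ = -(u + κ) by ring, h.odd, h.odd, h.odd, h.odd, neg_mul_neg, neg_mul_neg]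

theorem IsBracket.pairWeight_reflect (h : IsBracket br) (u : ℂ) :
    pairWeight br δ κ (u + κ) = pairWeight br δ κ (-u) := by
  rw [h.pairWeight_neg]
  unfold pairWeight
  ring_nf

theorem IsBracket.continuousAt_pairWeight (h : IsBracket br) {u : ℂ} (h1 : br u ≠ 0)
    (h2 : br (u - κ) ≠ 0) : ContinuousAt (pairWeight br δ κ) u := by
  have hc := h.entire.continuous
  unfold pairWeight
  refine ContinuousAt.div ?_ ?_ (mul_ne_zero h1 h2) <;> exact (by fun_prop : Continuous _).continuousAt

/-- The points `z i`, `i ∈ S`, are pairwise distinct modulo `ℤκ` and zeros of the bracket. -/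
def SeparatedBy {α : Type*} (br : ℂ → ℂ) (κ : ℂ) (S : Finset α) (z : α → ℂ) : Prop :=
  ∀ i ∈ S, ∀ j ∈ S, i ≠ j → ∀ n : ℤ, br (z i - z j + n * κ) ≠ 0

variable {α : Type*} [DecidableEq α]

theorem thetaQuot_pairWeight {A : Set ℂ} {c : ℂ} (h0 : c ∈ A)
    (h1 : c + κ ∈ A) : ThetaQuot br A 0 (fun t => pairWeight br δ κ (t - c)) := by
  refine ((ThetaQuot.div (br := br) (c := c + δ) h0).mul
    (ThetaQuot.div (br := br) (c := c - δ + κ) h1)).congr (by ring) fun t => ?_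
  rw [div_mul_div_comm, pairWeight]
  ring_nf

theorem IsBracket.thetaQuot_pairWeight_neg (h : IsBracket br) {A : Set ℂ} {c : ℂ} (h0 : c ∈ A)
    (h1 : c - κ ∈ A) : ThetaQuot br A 0 (fun t => pairWeight br δ κ (c - t)) := by
  refine ((ThetaQuot.div (br := br) (c := c - δ) h0).mul
    (ThetaQuot.div (br := br) (c := c + δ - κ) h1)).congr (by ring) fun t => ?_
  rw [div_mul_div_comm, ← neg_sub t c, h.pairWeight_neg]
  ring_nf

theorem IsBracket.tendsto_punctured (h : IsBracket br) {f g : ℂ → ℂ} {c l : ℂ}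
    (hg : ContinuousAt g c) (hl : g c = l) (hfg : ∀ t, br (t - c) ≠ 0 → f t = g t) :
    Tendsto f (𝓝[≠] c) (𝓝 l) := by
  subst hl
  refine (hg.tendsto.mono_left nhdsWithin_le_nhds).congr' ?_
  filter_upwards [h.eventually_punctured_ne_zero c c] with t ht
  exact (hfg t ht).symm

theorem IsBracket.tendsto_mul_pairWeight_self (h : IsBracket br) (hκ : br κ ≠ 0) (z : ℂ) :
    Tendsto (fun t => br (t - z) * pairWeight br δ κ (t - z)) (𝓝[≠] z)
        (𝓝 (br δ * br (δ - κ) / br κ)) := by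
  have hc := h.entire.continuous
  have hκ' : br (z - z - κ) ≠ 0 := by rw [sub_self, zero_sub, h.odd]; simpa using hκ
  refine h.tendsto_punctured
    (g := fun t => br (t - z - δ) * br (t - z + δ - κ) / br (t - z - κ)) ?_ ?_ fun t ht => ?_
  · exact ContinuousAt.div (by fun_prop) (by fun_prop) hκ'
  · simp only [sub_self, zero_sub, zero_add, h.odd]
    ring
  · rw [pairWeight]; field_simp

theorem IsBracket.tendsto_mul_pairWeight_self_neg (h : IsBracket br) (hκ : br κ ≠ 0) (z : ℂ) :
    Tendsto (fun t => br (t - z) * pairWeight br δ κ (z - t)) (𝓝[≠] z)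
        (𝓝 (-(br δ * br (δ - κ) / br κ))) := by
  have hc := h.entire.continuous
  have hκ' : br (z - z + κ) ≠ 0 := by simpa using hκ
  refine h.tendsto_punctured
    (g := fun t => br (t - z + δ) * br (t - z - δ + κ) / br (t - z + κ)) ?_ ?_ fun t ht => ?_
  · exact ContinuousAt.div (by fun_prop) (by fun_prop) hκ'
  · rw [h.sub_comm δ κ]
    simp only [sub_self, zero_sub, zero_add]
    ring_nf
  · rw [← neg_sub t z, h.pairWeight_neg]; field_simp

theorem IsBracket.tendsto_mul_pairWeight_add (h : IsBracket br) (hκ : br κ ≠ 0) (z : ℂ) :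
    Tendsto (fun t => br (t - (z + κ)) * pairWeight br δ κ (t - z)) (𝓝[≠] (z + κ))
        (𝓝 (br (κ - δ) * br δ / br κ)) := by
  have hc := h.entire.continuous
  refine h.tendsto_punctured
    (g := fun t => br (t - z - δ) * br (t - z + δ - κ) / br (t - z)) ?_ ?_ fun t ht => ?_
  · exact ContinuousAt.div (by fun_prop) (by fun_prop) (by simpa using hκ)
  · ring_nf
  · rw [pairWeight, sub_sub t z κ]; field_simp

theorem IsBracket.tendsto_mul_pairWeight_sub (h : IsBracket br) (hκ : br κ ≠ 0) (z : ℂ) :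
    Tendsto (fun t => br (t - (z - κ)) * pairWeight br δ κ (z - t)) (𝓝[≠] (z - κ))
        (𝓝 (-(br (κ - δ) * br δ / br κ))) := by
  have hc := h.entire.continuous
  have hκ' : br (z - κ - z) ≠ 0 := by rw [show z - κ - z = -κ by ring, h.odd]; simpa using hκ
  refine h.tendsto_punctured
    (g := fun t => br (t - z + δ) * br (t - z - δ + κ) / br (t - z)) ?_ ?_ fun t ht => ?_
  · exact ContinuousAt.div (by fun_prop) (by fun_prop) hκ'
  · rw [show z - κ - z + δ = -(κ - δ) by ring, show z - κ - z - δ + κ = -δ by ring,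
      show z - κ - z = -κ by ring, h.odd, h.odd, h.odd]
    ring
  · rw [show t - (z - κ) = t - z + κ by ring] at *
    rw [← neg_sub t z, h.pairWeight_neg]; field_simp

end Ruijsenaars

/-- The difference between the two sides of the subset-sum identity. -/
noncomputable def subsetDefect {α : Type*} [DecidableEq α] (br : ℂ → ℂ) (δ κ : ℂ) (S : Finset α)
    (w : ℕ → ℂ) (z : α → ℂ) : ℂ :=
  weightedSubsetSum S w (fun i j => pairWeight br δ κ (z i - z j))
    - weightedSubsetSum S w (fun i j => pairWeight br δ κ (z j - z i))

section Ruijsenaars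

variable {br : ℂ → ℂ} {δ κ : ℂ} {α : Type*} [DecidableEq α] {S : Finset α} {w : ℕ → ℂ} {a b : α}
  {z : α → ℂ}

theorem crossSum_congr {φ ψ : α → α → ℂ} {c d : α} (h : ∀ i ∈ S, ∀ j ∈ S, φ i j = ψ i j)
    (h1 : ∀ i ∈ S, φ a i = ψ c i) (h2 : ∀ i ∈ S, φ i b = ψ i d) :
    crossSum S w φ a b = crossSum S w ψ c d := by
  refine Finset.sum_congr rfl fun I hI => ?_
  rw [Finset.mem_powerset] at hI
  have hd : ∀ j ∈ S \ I, j ∈ S := fun j hj => (Finset.mem_sdiff.mp hj).1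
  congr 1
  congr 1
  · congr 1
    · exact Finset.prod_congr rfl fun i hi => h2 i (hI hi)
    · exact Finset.prod_congr rfl fun j hj => h1 j (hd j hj)
  · exact Finset.prod_congr rfl fun i hi => Finset.prod_congr rfl fun j hj =>
      h i (hI hi) j (hd j hj)

theorem IsBracket.tendsto_mul_subsetDefect (h : IsBracket br) (ha : a ∉ S) (hb : b ∉ S)
    (hab : a ≠ b) (hz : SeparatedBy br κ (insert b S) z) (n : ℤ) {c r r' : ℂ}
    (hc : c = z b + n * κ)
    (hr : Tendsto (fun t => br (t - c) * pairWeight br δ κ (t - z b)) (𝓝[≠] c) (𝓝 r))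
    (hr' : Tendsto (fun t => br (t - c) * pairWeight br δ κ (z b - t)) (𝓝[≠] c) (𝓝 r')) :
    Tendsto (fun t => br (t - c)
        * subsetDefect br δ κ (insert a (insert b S)) w (Function.update z a t)) (𝓝[≠] c)
      (𝓝 (r * (crossSum S w (fun i j => pairWeight br δ κ
            (Function.update z a c i - Function.update z a c j)) a b
          - crossSum S w (fun i j => pairWeight br δ κ
            (Function.update z a c j - Function.update z a c i)) b a)
        + r' * (crossSum S w (fun i j => pairWeight br δ κ
            (Function.update z a c i - Function.update z a c j)) b a
          - crossSum S w (fun i j => pairWeight br δ κ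
            (Function.update z a c j - Function.update z a c i)) a b))) := by
  have hs : Tendsto (fun t => br (t - c)) (𝓝[≠] c) (𝓝 0) :=
    h.tendsto_punctured (h.continuous_sub c).continuousAt (by simp [h.map_zero]) fun _ _ => rfl
  have hne : ∀ i ∈ S, i ≠ a ∧ i ≠ b := fun i hi =>
    ⟨fun e => ha (e ▸ hi), fun e => hb (e ▸ hi)⟩
  have hsep : ∀ i ∈ S, ∀ l : ℤ, br (z i - c + l * κ) ≠ 0 := fun i hi l => by
    have := hz i (by simp [hi]) b (by simp) (hne i hi).2 (l - n)
    rw [hc]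
    convert this using 2
    push_cast; ring
  have c1 : ∀ i ∈ S, ContinuousAt (fun t => pairWeight br δ κ (z i - t)) c := fun i hi => by
    refine ContinuousAt.comp (f := fun t => z i - t) (g := pairWeight br δ κ) ?_ (by fun_prop)
    refine h.continuousAt_pairWeight ?_ ?_
    · simpa using hsep i hi 0
    · simpa [sub_eq_add_neg] using hsep i hi (-1)
  have c2 : ∀ i ∈ S, ContinuousAt (fun t => pairWeight br δ κ (t - z i)) c := fun i hi => by
    refine ContinuousAt.comp (f := fun t => t - z i) (g := pairWeight br δ κ) ?_ (by fun_prop)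
    refine h.continuousAt_pairWeight ?_ ?_
    · rw [h.sub_comm]; simpa using hsep i hi 0
    · rw [show c - z i - κ = -(z i - c + κ) by ring, h.odd]; simpa using hsep i hi 1
  have hF := tendsto_mul_weightedSubsetSum (w := w) ha hb hab (c := c) (r := r) (r' := r')
    (φ := fun t i j => pairWeight br δ κ (Function.update z a t i - Function.update z a t j))
    (fun i hi => ⟨by simpa [hne i hi] using c1 i hi, by simpa [hne i hi] using c2 i hi,
      by simp [hne i hi, hab.symm, continuousAt_const],
      by simp [hne i hi, hab.symm, continuousAt_const],
      fun j hj => by simp [hne i hi, hne j hj, continuousAt_const]⟩) hs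
    (by simpa [hab.symm] using hr) (by simpa [hab.symm] using hr')
  have hG := tendsto_mul_weightedSubsetSum (w := w) ha hb hab (c := c) (r := r') (r' := r)
    (φ := fun t i j => pairWeight br δ κ (Function.update z a t j - Function.update z a t i))
    (fun i hi => ⟨by simpa [hne i hi] using c2 i hi, by simpa [hne i hi] using c1 i hi,
      by simp [hne i hi, hab.symm, continuousAt_const],
      by simp [hne i hi, hab.symm, continuousAt_const],
      fun j hj => by simp [hne i hi, hne j hj, continuousAt_const]⟩) hs
    (by simpa [hab.symm] using hr') (by simpa [hab.symm] using hr)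
  convert hF.sub hG using 1
  · funext t
    rw [subsetDefect]; ring
  · congr 1; ring

theorem IsBracket.tendsto_mul_subsetDefect_zero (h : IsBracket br)
    (hκ : ∀ n : ℤ, n ≠ 0 → br (n * κ) ≠ 0)
    (ih : ∀ (v : ℕ → ℂ), SeparatedBy br κ S z → subsetDefect br δ κ S v z = 0)
    (ha : a ∉ S) (hb : b ∉ S) (hab : a ≠ b) (hz : SeparatedBy br κ (insert b S) z) {c : ℂ}
    (hc : c = z b ∨ c = z b + κ ∨ c = z b - κ) :
    Tendsto (fun t => br (t - c)
        * subsetDefect br δ κ (insert a (insert b S)) w (Function.update z a t)) (𝓝[≠] c)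
      (𝓝 0) := by
  have hκ1 : br κ ≠ 0 := by simpa using hκ 1 one_ne_zero
  have hκm : br (-κ) ≠ 0 := by rw [h.odd]; simpa using hκ1
  have hκm2 : br (-κ - κ) ≠ 0 := by
    rw [show -κ - κ = ((-2 : ℤ) : ℂ) * κ by push_cast; ring]
    exact hκ _ (by norm_num)
  have hs : Tendsto (fun t => br (t - c)) (𝓝[≠] c) (𝓝 0) :=
    h.tendsto_punctured (h.continuous_sub c).continuousAt (by simp [h.map_zero]) fun _ _ => rfl
  have hne : ∀ i ∈ S, i ≠ a ∧ i ≠ b := fun i hi =>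
    ⟨fun e => ha (e ▸ hi), fun e => hb (e ▸ hi)⟩
  have hSz : SeparatedBy br κ S z := fun i hi j hj => hz i (by simp [hi]) j (by simp [hj])
  have ih' : ∀ v : ℕ → ℂ, weightedSubsetSum S v (fun i j => pairWeight br δ κ
        (Function.update z a c i - Function.update z a c j))
      = weightedSubsetSum S v (fun i j => pairWeight br δ κ
        (Function.update z a c j - Function.update z a c i)) := fun v => by
    have := ih v hSz
    rw [subsetDefect, sub_eq_zero] at this
    rw [weightedSubsetSum_congr (ψ := fun i j => pairWeight br δ κ (z i - z j)), this]
    · exact weightedSubsetSum_congr fun i hi j hj => by simp [hne i hi, hne j hj]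
    · exact fun i hi j hj => by simp [hne i hi, hne j hj]
  rcases hc with hc | hc | hc
  · have := h.tendsto_mul_subsetDefect (w := w) (δ := δ) ha hb hab hz 0 (c := c) (by simp [hc])
      (by rw [hc]; exact h.tendsto_mul_pairWeight_self hκ1 (z b))
      (by rw [hc]; exact h.tendsto_mul_pairWeight_self_neg hκ1 (z b))
    convert this using 2
    rw [crossSum_congr (a := a) (b := b) (c := b) (d := a) (fun i _ j _ => rfl),
      crossSum_congr (a := a) (b := b) (c := b) (d := a) (fun i _ j _ => rfl)]
    · ring
    all_goals
      intro i hi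
      simp [hne i hi, hab.symm, hc]
  · have h0 : Tendsto (fun t => br (t - c) * pairWeight br δ κ (z b - t)) (𝓝[≠] c) (𝓝 0) := by
      have hcont : ContinuousAt (fun t => pairWeight br δ κ (z b - t)) c := by
        refine ContinuousAt.comp (f := fun t => z b - t) (g := pairWeight br δ κ) ?_ (by fun_prop)
        rw [hc, show z b - (z b + κ) = -κ by ring]
        exact h.continuousAt_pairWeight hκm hκm2
      simpa using hs.mul (hcont.tendsto.mono_left nhdsWithin_le_nhds)
    have := h.tendsto_mul_subsetDefect (w := w) (δ := δ) ha hb hab hz 1 (c := c) (by simp [hc])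
      (by rw [hc]; exact h.tendsto_mul_pairWeight_add hκ1 (z b)) h0
    convert this using 2
    have key : ∀ i ∈ S, pairWeight br δ κ (c - z i) = pairWeight br δ κ (z i - z b) := by
      intro i _
      rw [hc, show z b + κ - z i = (z b - z i) + κ by ring, h.pairWeight_reflect, neg_sub]
    rw [crossSum_eq_mul, crossSum_eq_mul, ih', Finset.prod_congr rfl]
    · rw [sub_self]; ring
    all_goals
      intro i hi
      simp [hne i hi, hab.symm, key i hi]
  · have h0 : Tendsto (fun t => br (t - c) * pairWeight br δ κ (t - z b)) (𝓝[≠] c) (𝓝 0) := by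
      have hcont : ContinuousAt (fun t => pairWeight br δ κ (t - z b)) c := by
        refine ContinuousAt.comp (f := fun t => t - z b) (g := pairWeight br δ κ) ?_ (by fun_prop)
        rw [hc, show z b - κ - z b = -κ by ring]
        exact h.continuousAt_pairWeight hκm hκm2
      simpa using hs.mul (hcont.tendsto.mono_left nhdsWithin_le_nhds)
    have := h.tendsto_mul_subsetDefect (w := w) (δ := δ) ha hb hab hz (-1) (c := c)
      (by simp [hc, sub_eq_add_neg]) h0
      (by rw [hc]; exact h.tendsto_mul_pairWeight_sub hκ1 (z b))
    convert this using 2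
    have key : ∀ i ∈ S, pairWeight br δ κ (z i - c) = pairWeight br δ κ (z b - z i) := by
      intro i _
      rw [hc, show z i - (z b - κ) = (z i - z b) + κ by ring, h.pairWeight_reflect, neg_sub]
    rw [zero_mul, zero_add, crossSum_eq_mul, crossSum_eq_mul, ih', Finset.prod_congr rfl]
    · rw [sub_self]; ring
    all_goals
      intro i hi
      simp [hne i hi, hab.symm, key i hi]

theorem subsetDefect_congr {z' : α → ℂ} (h : ∀ i ∈ S, z i = z' i) :
    subsetDefect br δ κ S w z = subsetDefect br δ κ S w z' := by
  rw [subsetDefect, subsetDefect]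
  congr 1 <;> exact weightedSubsetSum_congr fun i hi j hj => by rw [h i hi, h j hj]

theorem IsBracket.subsetDefect_move (h : IsBracket br)
    (hκ : ∀ n : ℤ, n ≠ 0 → br (n * κ) ≠ 0)
    (ih : ∀ S' ⊂ S, ∀ (v : ℕ → ℂ), ∀ z : α → ℂ, SeparatedBy br κ S' z →
      subsetDefect br δ κ S' v z = 0)
    (ha : a ∈ S) {z' : α → ℂ} (hz : SeparatedBy br κ S z) (hz' : SeparatedBy br κ S z')
    (hzz : ∀ i ∈ S, i ≠ a → z' i = z i) :
    subsetDefect br δ κ S w z' = subsetDefect br δ κ S w z := by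
  set A : Set ℂ := {c | ∃ b ∈ S, b ≠ a ∧ (c = z b ∨ c = z b + κ ∨ c = z b - κ)} with hA
  have hpw : ∀ i ∈ S, ∀ j ∈ S, i ≠ j → ThetaQuot br A 0 (fun t => pairWeight br δ κ
      (Function.update z a t i - Function.update z a t j)) := by
    intro i hi j hj hij
    by_cases hia : i = a
    · subst hia
      simp only [Function.update_self, Function.update_of_ne hij.symm]
      exact thetaQuot_pairWeight ⟨j, hj, hij.symm, Or.inl rfl⟩ ⟨j, hj, hij.symm, Or.inr (Or.inl rfl)⟩
    · by_cases hja : j = a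
      · subst hja
        simp only [Function.update_self, Function.update_of_ne hij]
        exact h.thetaQuot_pairWeight_neg ⟨i, hi, hij, Or.inl rfl⟩ ⟨i, hi, hij, Or.inr (Or.inr rfl)⟩
      · simp only [Function.update_of_ne hia, Function.update_of_ne hja]
        exact ThetaQuot.const _
  have hsum : ∀ φ : ℂ → α → α → ℂ, (∀ i ∈ S, ∀ j ∈ S, i ≠ j → ThetaQuot br A 0 fun t => φ t i j) →
      ThetaQuot br A 0 fun t => weightedSubsetSum S w (φ t) := by
    intro φ hφ
    refine ThetaQuot.sum _ fun I hI => ThetaQuot.const_mul _ ?_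
    rw [Finset.mem_powerset] at hI
    refine (ThetaQuot.prod (T := fun _ => 0) I fun i hi => (ThetaQuot.prod (T := fun _ => 0) (S \ I)
      fun j hj => hφ i (hI hi) j (Finset.mem_sdiff.mp hj).1 fun e =>
        (Finset.mem_sdiff.mp hj).2 (e ▸ hi)).congr (by simp) fun _ => rfl).congr (by simp)
          fun _ => rfl
  have hg : ThetaQuot br A 0
      (fun t => subsetDefect br δ κ S w (Function.update z a t)) :=
    (hsum _ hpw).sub (hsum (fun t i j => pairWeight br δ κ
      (Function.update z a t j - Function.update z a t i)) fun i hi j hj hij =>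
        hpw j hj i hi hij.symm)
  obtain ⟨C, hC⟩ := h.thetaQuot_const hg fun c hc => by
    obtain ⟨b, hb, hba, hcb⟩ := hc
    have hS : insert a (insert b ((S.erase a).erase b)) = S := by
      rw [Finset.insert_erase (by simp [hb, hba]), Finset.insert_erase ha]
    have := h.tendsto_mul_subsetDefect_zero (S := (S.erase a).erase b) (a := a) (b := b) (w := w)
      (δ := δ) (z := z) hκ
      (fun v hv => ih _ (by
        refine Finset.ssubset_iff_subset_ne.mpr ⟨fun i hi => ?_, fun e => ?_⟩
        · exact Finset.mem_of_mem_erase (Finset.mem_of_mem_erase hi)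
        · rw [← e] at hb; simp at hb) v z hv)
      (by simp) (by simp) hba.symm
      (fun i hi j hj => hz i (by grind) j (by grind)) hcb
    rwa [hS] at this
  have havoid : ∀ y : α → ℂ, SeparatedBy br κ S y → (∀ i ∈ S, i ≠ a → y i = z i) →
      subsetDefect br δ κ S w y = C := by
    intro y hy hyz
    rw [← hC (y a) ?_]
    · refine subsetDefect_congr fun i hi => ?_
      by_cases hia : i = a
      · rw [hia, Function.update_self]
      · rw [Function.update_of_ne hia, hyz i hi hia]
    · rintro c ⟨b, hb, hba, rfl | rfl | rfl⟩
      · simpa [hyz b hb hba] using hy a ha b hb hba.symm 0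
      · have := hy a ha b hb hba.symm (-1)
        rw [hyz b hb hba] at this
        convert this using 2
        push_cast; ring
      · have := hy a ha b hb hba.symm 1
        rw [hyz b hb hba] at this
        convert this using 2
        push_cast; ring
  rw [havoid z' hz' hzz, havoid z hz fun _ _ _ => rfl]

instance countableInterFilter_cocountable_complex :
    CountableInterFilter (cocountable : Filter ℂ) :=
  CardinalInterFilter.toCountableInterFilter _ Cardinal.aleph0_lt_aleph_one

theorem IsBracket.subsetDefect_eq_zero (h : IsBracket br)
    (hκ : ∀ n : ℤ, n ≠ 0 → br (n * κ) ≠ 0) (S : Finset α) (w : ℕ → ℂ) (z : α → ℂ)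
    (hz : SeparatedBy br κ S z) : subsetDefect br δ κ S w z = 0 := by
  induction S using Finset.strongInduction generalizing w z with
  | H S ih =>
    have hs : ∀ᶠ s in (cocountable : Filter ℂ), ∀ i ∈ S, ∀ j ∈ S, ∀ n : ℤ,
        br (s - z i - z j + n * κ) ≠ 0 := by
      rw [Filter.eventually_all_finset]
      intro i _
      rw [Filter.eventually_all_finset]
      intro j _
      rw [eventually_countable_forall]
      intro n
      filter_upwards [h.eventually_cocountable one_ne_zero (-z i - z j + n * κ)] with s hs
      convert hs using 2
      ring
    obtain ⟨s, hs⟩ := hs.exists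
    have hsep : ∀ T ⊆ S, SeparatedBy br κ S fun i => if i ∈ T then s - z i else z i := by
      intro T _ i hi j hj hij n
      beta_reduce
      split_ifs with hiT hjT hjT
      · convert hz j hj i hi hij.symm n using 2
        ring
      · exact hs i hi j hj n
      · rw [show z i - (s - z j) + n * κ = -(s - z i - z j + ((-n : ℤ) : ℂ) * κ) by push_cast; ring,
          h.odd, neg_ne_zero]
        exact hs i hi j hj (-n)
      · exact hz i hi j hj hij n
    have hmove : ∀ T ⊆ S, subsetDefect br δ κ S w (fun i => if i ∈ T then s - z i else z i)
        = subsetDefect br δ κ S w z := by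
      intro T
      induction T using Finset.induction_on with
      | empty => simp
      | insert a T haT ihT =>
        intro hT
        have hTS : T ⊆ S := fun i hi => hT (Finset.mem_insert_of_mem hi)
        rw [← ihT hTS]
        refine h.subsetDefect_move hκ ih (hT (Finset.mem_insert_self a T)) (hsep T hTS)
          (hsep _ hT) fun i _ hia => ?_
        simp [hia]
    have h1 := hmove S subset_rfl
    have h2 : subsetDefect br δ κ S w (fun i => if i ∈ S then s - z i else z i)
        = -subsetDefect br δ κ S w z := by
      rw [subsetDefect, subsetDefect, neg_sub]
      congr 1
      all_goals
        refine weightedSubsetSum_congr fun i hi j hj => ?_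
        simp [hi, hj]
    rw [h2] at h1
    exact self_eq_neg.mp h1.symm

end Ruijsenaars

/-- The shifted factorial `[z][z+δ]⋯[z+(n-1)δ]`. -/
def bpoch (br : ℂ → ℂ) (δ z : ℂ) (n : ℕ) : ℂ := ∏ a ∈ Finset.range n, br (z + a * δ)

/-- The summand of the multiple series with starting points `x` and end points `e`. -/
noncomputable def multiTerm {ι : Type*} [Fintype ι] (br : ℂ → ℂ) (δ κ : ℂ) (x e : ι → ℂ)
    (μ : ι → ℕ) : ℂ :=
  ∏ i, ∏ j, bpoch br δ (x i - e j) (μ i) * bpoch br δ (x i - x j + (1 - μ j) * δ - κ) (μ i)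
    / (bpoch br δ (x i - x j - μ j * δ) (μ i) * bpoch br δ (x i - e j + δ - κ) (μ i))

/-- No bracket value `[aδ + bκ]` with `(a, b) ≠ (0, 0)`, or `[x_i - x_j + aδ + bκ]` with `i ≠ j`,
vanishes. -/
structure StringGeneric {ι : Type*} (br : ℂ → ℂ) (δ κ : ℂ) (x : ι → ℂ) : Prop where
  const : ∀ a b : ℤ, a ≠ 0 ∨ b ≠ 0 → br (a * δ + b * κ) ≠ 0
  diff : ∀ i j, i ≠ j → ∀ a b : ℤ, br (x i - x j + a * δ + b * κ) ≠ 0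

section strings

variable {br : ℂ → ℂ} {δ κ : ℂ} {ι : Type*}

theorem StringGeneric.neg_end {x : ι → ℂ} (hx : StringGeneric br δ κ x)
    (n : ι → ℕ) : StringGeneric br δ κ (fun i => -(x i + n i * δ)) := by
  refine ⟨hx.const, fun i j hij a b => ?_⟩
  convert hx.diff j i hij.symm (a - n i + n j) b using 2
  push_cast; ring

theorem weightedSubsetSum_image {α β : Type*} [DecidableEq α] [DecidableEq β] {S : Finset α} {w : ℕ → ℂ}
    {φ : β → β → ℂ} {f : α → β} (hf : Set.InjOn f S) :
    weightedSubsetSum (S.image f) w φ = weightedSubsetSum S w (fun i j => φ (f i) (f j)) := by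
  rw [weightedSubsetSum, weightedSubsetSum, Finset.powerset_image, Finset.sum_image]
  · refine Finset.sum_congr rfl fun I hI => ?_
    rw [Finset.mem_powerset] at hI
    have hI' : Set.InjOn f I := hf.mono (by exact_mod_cast hI)
    have hS : S.image f \ I.image f = (S \ I).image f := by
      ext b
      simp only [Finset.mem_sdiff, Finset.mem_image]
      constructor
      · rintro ⟨⟨a, ha, rfl⟩, hb⟩
        exact ⟨a, ⟨ha, fun h => hb ⟨a, h, rfl⟩⟩, rfl⟩
      · rintro ⟨a, ⟨ha, haI⟩, rfl⟩
        refine ⟨⟨a, ha, rfl⟩, ?_⟩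
        rintro ⟨a', ha', e⟩
        exact haI (hf (hI ha') ha e ▸ ha')
    rw [Finset.card_image_of_injOn hI', Finset.prod_image hI', hS]
    congr 1
    refine Finset.prod_congr rfl fun i _ => Finset.prod_image ?_
    exact hf.mono (by exact_mod_cast Finset.sdiff_subset)
  · intro I hI J hJ hIJ
    rw [Finset.mem_coe, Finset.mem_powerset] at hI hJ
    ext a
    have hIJ' : I.image f = J.image f := hIJ
    constructor
    · intro ha
      have hfa := Finset.mem_image_of_mem f ha
      rw [hIJ'] at hfa
      obtain ⟨b, hb, e⟩ := Finset.mem_image.mp hfa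
      exact hf (hJ hb) (hI ha) e ▸ hb
    · intro ha
      have hfa := Finset.mem_image_of_mem f ha
      rw [← hIJ'] at hfa
      obtain ⟨b, hb, e⟩ := Finset.mem_image.mp hfa
      exact hf (hI hb) (hJ ha) e ▸ hb

variable [Fintype ι] [DecidableEq ι]

/-- If `φ ⟨i, a+1⟩ ⟨i, a⟩ = 0`, only the subsets that are initial segments of every string
contribute. -/
theorem weightedSubsetSum_sigma_range (n : ι → ℕ) (w : ℕ → ℂ) (φ : ((_ : ι) × ℕ) → ((_ : ι) × ℕ) → ℂ)
    (hφ : ∀ i a, φ ⟨i, a + 1⟩ ⟨i, a⟩ = 0) :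
    weightedSubsetSum (Finset.univ.sigma fun i => Finset.range (n i)) w φ
      = ∑ μ ∈ Fintype.piFinset (fun i => Finset.range (n i + 1)), w (∑ i, μ i) *
        ∏ i, ∏ a ∈ Finset.range (μ i), ∏ j, ∏ b ∈ Finset.Ico (μ j) (n j), φ ⟨i, a⟩ ⟨j, b⟩ := by
  set seg : (ι → ℕ) → Finset ((_ : ι) × ℕ) := fun μ => Finset.univ.sigma fun i =>
    Finset.range (μ i) with hseg
  have hinj : Function.Injective seg := by
    intro μ ν hμν
    funext i
    have : ∀ a, a < μ i ↔ a < ν i := fun a => by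
      have := congrArg (fun s => (⟨i, a⟩ : (_ : ι) × ℕ) ∈ s) hμν
      simpa [hseg] using this
    exact le_antisymm (by simpa using (this (ν i)).not.mpr (lt_irrefl _))
      (by simpa using (this (μ i)).not.mp (lt_irrefl _))
  rw [weightedSubsetSum, ← Finset.sum_subset (s₁ := (Fintype.piFinset
    (fun i => Finset.range (n i + 1))).image seg), Finset.sum_image fun _ _ _ _ h => hinj h]
  · refine Finset.sum_congr rfl fun μ hμ => ?_
    have hcard : (seg μ).card = ∑ i, μ i := by simp [hseg]
    rw [hcard]
    congr 1
    · rw [hseg, Finset.prod_sigma]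
      refine Finset.prod_congr rfl fun i _ => Finset.prod_congr rfl fun a _ => ?_
      rw [← Finset.prod_sigma]
      refine Finset.prod_congr ?_ fun _ _ => rfl
      ext ⟨j, b⟩
      simp
      omega
  · intro I hI
    obtain ⟨μ, hμ, rfl⟩ := Finset.mem_image.mp hI
    rw [Finset.mem_powerset]
    rintro ⟨i, a⟩
    have := Fintype.mem_piFinset.mp hμ i
    simp [hseg] at this ⊢
    omega
  · intro I hI hI'
    rw [Finset.mem_powerset] at hI
    by_contra hne
    apply hI'
    have hdown : ∀ i a, (⟨i, a + 1⟩ : (_ : ι) × ℕ) ∈ I → (⟨i, a⟩ : (_ : ι) × ℕ) ∈ I := by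
      intro i a ha
      by_contra hna
      apply hne
      refine mul_eq_zero_of_right _ (Finset.prod_eq_zero ha (Finset.prod_eq_zero (i := ⟨i, a⟩) ?_
        (hφ i a)))
      have := hI ha
      simp [hna] at this ⊢
      omega
    have hex : ∀ i, ∃ a, (⟨i, a⟩ : (_ : ι) × ℕ) ∉ I := fun i => ⟨n i, fun h => by
      simpa using hI h⟩
    classical
    refine Finset.mem_image.mpr ⟨fun i => Nat.find (hex i), ?_, ?_⟩
    · rw [Fintype.mem_piFinset]
      intro i
      rw [Finset.mem_range, Nat.lt_succ_iff]
      refine Nat.find_min' _ fun h => by simpa using hI h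
    · ext ⟨i, a⟩
      simp only [hseg, Finset.mem_sigma, Finset.mem_univ, true_and, Finset.mem_range]
      constructor
      · intro h
        exact not_not.mp (Nat.find_min _ h)
      · intro h
        by_contra hle
        rw [not_lt] at hle
        refine Nat.find_spec (hex i) ?_
        generalize Nat.find (hex i) = N at hle
        induction a, hle using Nat.le_induction with
        | base => exact h
        | succ a _ ih => exact ih (hdown i _ h)

theorem prod_Ico_pairWeight {u : ℂ} {μ n : ℕ} (h : μ ≤ n)
    (h0 : ∀ b : ℕ, μ ≤ b → br (u - b * δ) ≠ 0)
    (h1 : ∀ b : ℤ, br (u + b * δ - κ) ≠ 0) :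
    ∏ b ∈ Finset.Ico μ n, pairWeight br δ κ (u - b * δ)
      = br (u - n * δ) * br (u + (1 - μ) * δ - κ)
        / (br (u - μ * δ) * br (u - n * δ + δ - κ)) := by
  have h1' : ∀ v : ℂ, ∀ b : ℤ, v = u + b * δ - κ → br v ≠ 0 := fun v b e => e ▸ h1 b
  induction n, h using Nat.le_induction with
  | base =>
    have := h0 μ le_rfl
    have := h1' (u + (1 - μ) * δ - κ) (1 - μ) (by push_cast; ring)
    rw [Finset.Ico_self, Finset.prod_empty, show u - μ * δ + δ - κ = u + (1 - μ) * δ - κ by ring,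
      div_self (mul_ne_zero ‹_› ‹_›)]
  | succ n hn ih =>
    have := h0 μ le_rfl
    have := h0 n hn
    have := h1' (u - n * δ + δ - κ) (1 - n) (by push_cast; ring)
    have := h1' (u - n * δ - κ) (- n) (by push_cast; ring)
    rw [← Finset.prod_Ico_mul_eq_prod_Ico_add_one hn, ih, pairWeight,
      show u - ((n + 1 : ℕ) : ℂ) * δ = u - n * δ - δ by push_cast; ring,
      show u - n * δ - δ + δ - κ = u - n * δ - κ by ring]
    field_simp

theorem sum_multiTerm_string (h : IsBracket br) {x : ι → ℂ} (hx : StringGeneric br δ κ x)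
    (n : ι → ℕ) (k : ℕ) :
    ∑ μ ∈ Finset.piAntidiag Finset.univ k, multiTerm br δ κ x (fun i => x i + n i * δ) μ
      = weightedSubsetSum (Finset.univ.sigma fun i => Finset.range (n i)) (fun l => if l = k then 1 else 0)
        (fun p q => pairWeight br δ κ ((x p.1 + p.2 * δ) - (x q.1 + q.2 * δ))) := by
  rw [weightedSubsetSum_sigma_range _ _ _ ?_]
  · simp only [ite_mul, one_mul, zero_mul]
    rw [← Finset.sum_filter]
    symm
    have hsub : (Fintype.piFinset fun i => Finset.range (n i + 1)).filter (fun μ => ∑ i, μ i = k)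
        ⊆ Finset.piAntidiag Finset.univ k := by
      intro μ hμ
      rw [Finset.mem_filter] at hμ
      simp [hμ.2]
    rw [← Finset.sum_subset hsub]
    · refine Finset.sum_congr rfl fun μ hμ => Finset.prod_congr rfl fun i _ => ?_
      rw [Finset.prod_comm]
      refine Finset.prod_congr rfl fun j _ => ?_
      simp only [bpoch, ← Finset.prod_mul_distrib, ← Finset.prod_div_distrib]
      refine Finset.prod_congr rfl fun a ha => ?_
      rw [Finset.mem_range] at ha
      have hμj : μ j ≤ n j := by
        have := Fintype.mem_piFinset.mp (Finset.mem_filter.mp hμ).1 j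
        simp at this
        omega
      have := prod_Ico_pairWeight (br := br) (δ := δ) (κ := κ) (u := x i - x j + a * δ) hμj ?_ ?_
      · convert this using 2
        · exact congrArg _ (by ring)
        all_goals ring_nf
      · intro b hb
        by_cases hij : i = j
        · subst hij
          convert hx.const (a - b) 0 (by left; omega) using 2
          push_cast; ring
        · convert hx.diff i j hij (a - b) 0 using 2
          push_cast; ring
      · intro b
        by_cases hij : i = j
        · subst hij
          convert hx.const (a + b) (-1) (by right; omega) using 2
          push_cast; ring
        · convert hx.diff i j hij (a + b) (-1) using 2
          push_cast; ring
    · intro μ hμ hμ'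
      have : ∃ i, n i < μ i := by
        by_contra! hle
        apply hμ'
        rw [Finset.mem_filter, Fintype.mem_piFinset]
        exact ⟨fun i => by simpa [Nat.lt_succ_iff] using hle i, by simpa using hμ⟩
      obtain ⟨i, hi⟩ := this
      refine Finset.prod_eq_zero (Finset.mem_univ i) (Finset.prod_eq_zero (Finset.mem_univ i) ?_)
      have : bpoch br δ (x i - (x i + n i * δ)) (μ i) = 0 := by
        refine Finset.prod_eq_zero (Finset.mem_range.mpr hi) ?_
        rw [← h.map_zero]
        congr 1; ring
      rw [this, zero_mul, zero_div]
  · intro i a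
    rw [pairWeight, show x i + ((a + 1 : ℕ) : ℂ) * δ - (x i + a * δ) - δ = 0 by push_cast; ring,
      h.map_zero]
    simp

/-- The transformation for end points `e_i = x_i + n_i δ`. -/
theorem sum_multiTerm_eq_of_string (h : IsBracket br) {x : ι → ℂ} (hx : StringGeneric br δ κ x)
    (n : ι → ℕ) (k : ℕ) :
    ∑ μ ∈ Finset.piAntidiag Finset.univ k, multiTerm br δ κ x (fun i => x i + n i * δ) μ
      = ∑ μ ∈ Finset.piAntidiag Finset.univ k,
        multiTerm br δ κ (fun i => -(x i + n i * δ)) (fun i => -x i) μ := by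
  have h2 := sum_multiTerm_string h (hx.neg_end n) n k
  rw [show (fun i => -(x i + n i * δ) + n i * δ) = fun i => -x i by funext i; ring] at h2
  rw [h2, sum_multiTerm_string h hx]
  set S : Finset ((_ : ι) × ℕ) := Finset.univ.sigma fun i => Finset.range (n i) with hS
  set f : ((_ : ι) × ℕ) → ((_ : ι) × ℕ) := fun p => ⟨p.1, n p.1 - 1 - p.2⟩ with hf
  have hmem : ∀ p, p ∈ S ↔ p.2 < n p.1 := fun p => by simp [hS]
  have hinv : ∀ p ∈ S, f (f p) = p := fun ⟨i, a⟩ hp => by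
    rw [hmem] at hp
    simp [hf] at hp ⊢
    omega
  have hfS : ∀ p ∈ S, f p ∈ S := fun ⟨i, a⟩ hp => by
    rw [hmem] at hp ⊢
    simp [hf] at hp ⊢
    omega
  have himg : S.image f = S := by
    ext p
    rw [Finset.mem_image]
    exact ⟨fun ⟨q, hq, e⟩ => e ▸ hfS q hq, fun hp => ⟨f p, hfS p hp, hinv p hp⟩⟩
  have hinj : Set.InjOn f S := fun p hp q hq e => by
    rw [← hinv p hp, e, hinv q hq]
  have hsep : SeparatedBy br κ S (fun p => x p.1 + p.2 * δ) := by
    rintro ⟨i, a⟩ _ ⟨j, b⟩ _ hij l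
    by_cases hne : i = j
    · subst hne
      convert hx.const (a - b) l (by left; simpa [sub_eq_zero] using hij) using 2
      push_cast; ring
    · convert hx.diff i j hne (a - b) l using 2
      push_cast; ring
  have hR := h.subsetDefect_eq_zero (δ := δ)
    (fun l hl => by simpa using hx.const 0 l (Or.inr hl)) S (fun l => if l = k then 1 else 0) _ hsep
  rw [subsetDefect, sub_eq_zero] at hR
  rw [hR]
  conv_rhs => rw [← himg, weightedSubsetSum_image hinj]
  refine weightedSubsetSum_congr fun p hp q hq => ?_
  congr 1
  rw [hmem] at hp hq
  simp only [hf]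
  rw [Nat.sub_sub, Nat.sub_sub, Nat.cast_sub (by omega), Nat.cast_sub (by omega)]
  push_cast
  ring

end strings

/-- Non-vanishing of the bracket values that relate the starting points `x` and end points `e`. -/
structure EndGeneric {ι : Type*} (br : ℂ → ℂ) (δ κ : ℂ) (x e : ι → ℂ) : Prop where
  start_end_sub : ∀ i j, ∀ a : ℤ, br (x i - e j + a * δ - κ) ≠ 0
  start_end : ∀ i j, i ≠ j → ∀ a : ℤ, br (x i - e j + a * δ) ≠ 0
  end_end : ∀ i j, i ≠ j → ∀ a : ℤ, br (e i - e j + a * δ) ≠ 0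

section continuation

variable {br : ℂ → ℂ} {δ κ : ℂ} {A : Set ℂ}

theorem IsBracket.thetaQuot_bpoch_const_sub (h : IsBracket br) {u v : ℂ} {n : ℕ}
    (hv : ∀ a : ℕ, v + a * δ ∈ A) :
    ThetaQuot br A (n * (u - v)) (fun t => bpoch br δ (u - t) n / bpoch br δ (v - t) n) := by
  refine (ThetaQuot.prod (T := fun _ => u - v)
    (f := fun (a : ℕ) t => br (u - t + a * δ) / br (v - t + a * δ)) (Finset.range n) fun a _ =>
      (ThetaQuot.div (br := br) (c := u + a * δ) (hv a)).congr (by ring) fun t => ?_).congr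
        (by simp [mul_sub]) fun t => ?_
  · rw [show u - t + a * δ = -(t - (u + a * δ)) by ring,
      show v - t + a * δ = -(t - (v + a * δ)) by ring, h.odd, h.odd, neg_div_neg_eq]
  · rw [bpoch, bpoch, Finset.prod_div_distrib]

theorem thetaQuot_bpoch_add_const {u v : ℂ} {n : ℕ} (hv : ∀ a : ℕ, -v - a * δ ∈ A) :
    ThetaQuot br A (n * (v - u)) (fun t => bpoch br δ (t + u) n / bpoch br δ (t + v) n) := by
  refine (ThetaQuot.prod (T := fun _ => v - u)
    (f := fun (a : ℕ) t => br (t + u + a * δ) / br (t + v + a * δ)) (Finset.range n) fun a _ =>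
      (ThetaQuot.div (br := br) (c := -u - a * δ) (hv a)).congr (by ring) fun t => ?_).congr
        (by simp [mul_sub]) fun t => ?_
  · ring_nf
  · rw [bpoch, bpoch, Finset.prod_div_distrib]

variable {ι : Type*} [DecidableEq ι] {x e : ι → ℂ}

theorem EndGeneric.update (h : IsBracket br) (hx : StringGeneric br δ κ x)
    (he : EndGeneric br δ κ x e) (i₀ : ι) (n : ℕ) :
    EndGeneric br δ κ x (Function.update e i₀ (x i₀ + n * δ)) := by
  refine ⟨fun i j a => ?_, fun i j hij a => ?_, fun i j hij a => ?_⟩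
  · by_cases hj : j = i₀
    · subst hj
      rw [Function.update_self]
      by_cases hij : i = j
      · subst hij
        convert hx.const (a - n) (-1) (by right; omega) using 2
        push_cast; ring
      · convert hx.diff i j hij (a - n) (-1) using 2
        push_cast; ring
    · rw [Function.update_of_ne hj]
      exact he.start_end_sub i j a
  · by_cases hj : j = i₀
    · subst hj
      rw [Function.update_self]
      convert hx.diff i j hij (a - n) 0 using 2
      push_cast; ring
    · rw [Function.update_of_ne hj]
      exact he.start_end i j hij a
  · by_cases hi : i = i₀
    · subst hi
      rw [Function.update_self, Function.update_of_ne hij.symm]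
      convert he.start_end i j hij (a + n) using 2
      push_cast; ring
    · by_cases hj : j = i₀
      · subst hj
        rw [Function.update_self, Function.update_of_ne hi,
          show e i - (x j + n * δ) + a * δ = -(x j - e i + ((n - a : ℤ) : ℂ) * δ) by
            push_cast; ring, h.odd, neg_ne_zero]
        exact he.start_end j i (Ne.symm hij) _
      · rw [Function.update_of_ne hi, Function.update_of_ne hj]
        exact he.end_end i j hij a

variable [Fintype ι]

theorem IsBracket.thetaQuot_multiTerm_end (h : IsBracket br) (he : EndGeneric br δ κ x e) (i₀ : ι)
    (μ : ι → ℕ) :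
    ThetaQuot br {c | br (e i₀ - c) ≠ 0} ((κ - δ) * ∑ i, μ i)
      (fun t => multiTerm br δ κ x (Function.update e i₀ t) μ) := by
  refine (ThetaQuot.prod (T := fun i => ∑ j, if j = i₀ then (μ i : ℂ) * (κ - δ) else 0)
    Finset.univ fun i _ => ThetaQuot.prod Finset.univ fun j _ => ?_).congr ?_ fun t => rfl
  · by_cases hj : j = i₀
    · subst hj
      simp only [Function.update_self, if_true]
      refine ((h.thetaQuot_bpoch_const_sub (u := x i) (v := x i + δ - κ) (n := μ i) (δ := δ)
        (A := {c | br (e j - c) ≠ 0}) fun a => ?_).const_mul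
          (bpoch br δ (x i - x j + (1 - μ j) * δ - κ) (μ i)
            / bpoch br δ (x i - x j - μ j * δ) (μ i))).congr (by ring) fun t => ?_
      · rw [Set.mem_ofPred_eq, h.sub_comm, neg_ne_zero]
        convert he.start_end_sub i j (1 + a) using 2
        push_cast; ring
      · rw [div_mul_div_comm, mul_comm, show x i - t + δ - κ = x i + δ - κ - t by ring]
    · simp only [Function.update_of_ne hj, if_neg hj]
      exact ThetaQuot.const _
  · simp [Finset.mul_sum, mul_comm]

theorem IsBracket.thetaQuot_multiTerm_neg_end (h : IsBracket br) (he : EndGeneric br δ κ x e)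
    (i₀ : ι) (μ : ι → ℕ) :
    ThetaQuot br {c | br (e i₀ - c) ≠ 0} ((κ - δ) * ∑ i, μ i)
      (fun t => multiTerm br δ κ (fun i => -Function.update e i₀ t i) (fun i => -x i) μ) := by
  have hA : ∀ j, ∀ a : ℤ, x j + a * δ - κ ∈ {c | br (e i₀ - c) ≠ 0} := fun j a => by
    rw [Set.mem_ofPred_eq, h.sub_comm, neg_ne_zero]
    convert he.start_end_sub j i₀ a using 2
    ring
  have hA' : ∀ j, j ≠ i₀ → ∀ a : ℤ, e j + a * δ ∈ {c | br (e i₀ - c) ≠ 0} := fun j hj a => by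
    rw [Set.mem_ofPred_eq, h.sub_comm, neg_ne_zero]
    convert he.end_end j i₀ hj a using 2
    ring
  refine (ThetaQuot.prod (T := fun i => ∑ j, if j = i₀ then (μ i : ℂ) * (κ - δ) else 0)
    Finset.univ fun i _ => ThetaQuot.prod Finset.univ fun j _ => ?_).congr ?_ fun t => rfl
  · by_cases hi : i = i₀
    · subst hi
      have h1 := h.thetaQuot_bpoch_const_sub (u := x j) (v := x j + δ - κ) (n := μ i) (δ := δ)
        (A := {c | br (e i - c) ≠ 0}) fun a => by
          convert hA j (1 + a) using 1
          push_cast; ring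
      by_cases hj : j = i
      · subst hj
        simp only [Function.update_self, if_true]
        refine (h1.const_mul (bpoch br δ ((1 - μ j) * δ - κ) (μ j)
            / bpoch br δ (- μ j * δ) (μ j))).congr (by ring) fun t => ?_
        rw [div_mul_div_comm, show -t - -x j = x j - t by ring,
          show x j - t + δ - κ = x j + δ - κ - t by ring, show -t - -t - μ j * δ = - μ j * δ by ring,
          show -t - -t + (1 - μ j) * δ - κ = (1 - μ j) * δ - κ by ring]
        ring
      · simp only [Function.update_self, if_neg hj, Function.update_of_ne hj]
        have h2 := h.thetaQuot_bpoch_const_sub (u := e j + (1 - μ j) * δ - κ) (v := e j - μ j * δ)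
          (n := μ i) (δ := δ) (A := {c | br (e i - c) ≠ 0}) fun a => by
            convert hA' j hj (a - μ j) using 1
            push_cast; ring
        refine (h1.mul h2).congr (by ring) fun t => ?_
        rw [div_mul_div_comm, show -t - -x j = x j - t by ring,
          show x j - t + δ - κ = x j + δ - κ - t by ring,
          show -t - -e j - μ j * δ = e j - μ j * δ - t by ring,
          show -t - -e j + (1 - μ j) * δ - κ = e j + (1 - μ j) * δ - κ - t by ring,
          mul_comm (bpoch br δ (e j - μ j * δ - t) (μ i))]
    · by_cases hj : j = i₀
      · subst hj
        simp only [Function.update_self, if_true, Function.update_of_ne hi]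
        have h2 := thetaQuot_bpoch_add_const (br := br) (u := -e i + (1 - μ j) * δ - κ)
          (v := -e i - μ j * δ) (n := μ i) (δ := δ) (A := {c | br (e j - c) ≠ 0}) fun a => by
            convert hA' i hi (μ j - a) using 1
            push_cast; ring
        refine (h2.const_mul (bpoch br δ (-e i - -x j) (μ i)
            / bpoch br δ (-e i - -x j + δ - κ) (μ i))).congr (by ring) fun t => ?_
        rw [div_mul_div_comm, show -e i - -t - μ j * δ = t + (-e i - μ j * δ) by ring,
          show -e i - -t + (1 - μ j) * δ - κ = t + (-e i + (1 - μ j) * δ - κ) by ring,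
          mul_comm (bpoch br δ (-e i - -x j + δ - κ) (μ i))]
      · simp only [Function.update_of_ne hi, Function.update_of_ne hj, if_neg hj]
        exact ThetaQuot.const _
  · simp [Finset.mul_sum, mul_comm]

/-- The transformation for generic starting and end points. -/
theorem IsBracket.sum_multiTerm_eq (h : IsBracket br) (hx : StringGeneric br δ κ x)
    (he : EndGeneric br δ κ x e) (k : ℕ) :
    ∑ μ ∈ Finset.piAntidiag Finset.univ k, multiTerm br δ κ x e μ
      = ∑ μ ∈ Finset.piAntidiag Finset.univ k,
        multiTerm br δ κ (fun i => -e i) (fun i => -x i) μ := by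
  suffices ∀ T : Finset ι, ∀ e, EndGeneric br δ κ x e →
      (∀ i ∉ T, ∃ n : ℕ, e i = x i + n * δ) →
      ∑ μ ∈ Finset.piAntidiag Finset.univ k, multiTerm br δ κ x e μ
        = ∑ μ ∈ Finset.piAntidiag Finset.univ k,
          multiTerm br δ κ (fun i => -e i) (fun i => -x i) μ from
    this Finset.univ e he fun i hi => absurd (Finset.mem_univ i) hi
  intro T
  induction T using Finset.induction_on with
  | empty =>
    intro e _ hn
    choose n hn using fun i => hn i (Finset.notMem_empty i)
    obtain rfl : e = fun i => x i + n i * δ := funext hn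
    exact sum_multiTerm_eq_of_string h hx n k
  | insert i₀ T _ ih =>
    intro e he hn
    have hT : ∀ μ ∈ Finset.piAntidiag (Finset.univ : Finset ι) k, ((∑ i, μ i : ℕ) : ℂ) = k := by
      intro μ hμ
      have : ∑ i, μ i = k := by simpa using hμ
      rw [this]
    have hg : ThetaQuot br {c | br (e i₀ - c) ≠ 0} ((κ - δ) * k) (fun t =>
        ∑ μ ∈ Finset.piAntidiag Finset.univ k, multiTerm br δ κ x (Function.update e i₀ t) μ
        - ∑ μ ∈ Finset.piAntidiag Finset.univ k,
          multiTerm br δ κ (fun i => -Function.update e i₀ t i) (fun i => -x i) μ) := by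
      refine (ThetaQuot.sum _ fun μ hμ => ?_).sub (ThetaQuot.sum _ fun μ hμ => ?_)
      · exact (h.thetaQuot_multiTerm_end he i₀ μ).congr (by rw [← hT μ hμ])
          fun _ => rfl
      · exact (h.thetaQuot_multiTerm_neg_end he i₀ μ).congr (by rw [← hT μ hμ])
          fun _ => rfl
    have hδ : ∀ n : ℕ, 1 ≤ n → br (n * δ) ≠ 0 := fun n hn => by
      simpa using hx.const n 0 (Or.inl (by omega))
    have := h.thetaQuot_eq_zero hδ hg (t₀ := x i₀) fun n => by
      rw [sub_eq_zero]
      refine ih _ (he.update h hx i₀ n) fun i hi => ?_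
      by_cases hii : i = i₀
      · exact ⟨n, by rw [hii, Function.update_self]⟩
      · rw [Function.update_of_ne hii]
        exact hn i (by simp [hi, hii])
    simpa [sub_eq_zero] using this

end continuation

section sfac

variable {br : ℂ → ℂ} {δ κ : ℂ}

theorem sfac_natCast (z : ℂ) (n : ℕ) : sfac br δ z (n : ℤ) = bpoch br δ z n := by
  rw [sfac, if_pos (Int.natCast_nonneg n), Int.toNat_natCast, bpoch]

@[simp] theorem sfac_zero (z : ℂ) : sfac br δ z 0 = 1 := by
  simp [sfac]

theorem sfac_neg_natCast (z : ℂ) (n : ℕ) :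
    sfac br δ z (-(n : ℤ)) = (bpoch br δ (z - n * δ) n)⁻¹ := by
  rcases Nat.eq_zero_or_pos n with rfl | hn
  · simp [bpoch]
  · rw [sfac, if_neg (by omega), neg_neg, Int.toNat_natCast, bpoch]
    congr 1
    refine Finset.prod_congr rfl fun a _ => congrArg br ?_
    push_cast; ring

theorem bpoch_succ (z : ℂ) (n : ℕ) : bpoch br δ z (n + 1) = bpoch br δ z n * br (z + n * δ) :=
  Finset.prod_range_succ _ _

theorem bpoch_succ' (z : ℂ) (n : ℕ) : bpoch br δ z (n + 1) = br z * bpoch br δ (z + δ) n := by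
  rw [bpoch, Finset.prod_range_succ', mul_comm, bpoch]
  congr 1
  · simp
  · refine Finset.prod_congr rfl fun a _ => congrArg br ?_
    push_cast; ring

theorem bpoch_ne_zero {z : ℂ} {n : ℕ} (h : ∀ a : ℕ, br (z + a * δ) ≠ 0) : bpoch br δ z n ≠ 0 :=
  Finset.prod_ne_zero_iff.mpr fun a _ => h a

theorem sfac_ne_zero {z : ℂ} (h : ∀ a : ℤ, br (z + a * δ) ≠ 0) (n : ℤ) : sfac br δ z n ≠ 0 := by
  obtain ⟨n, rfl | rfl⟩ := n.eq_nat_or_neg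
  · rw [sfac_natCast]
    exact bpoch_ne_zero fun a => by simpa using h a
  · rw [sfac_neg_natCast]
    refine inv_ne_zero (bpoch_ne_zero fun a => ?_)
    convert h (a - n) using 2
    push_cast; ring

theorem sfac_add_one {z : ℂ} (h : ∀ a : ℤ, br (z + a * δ) ≠ 0) (n : ℤ) :
    sfac br δ z (n + 1) = sfac br δ z n * br (z + n * δ) := by
  obtain ⟨n, rfl | rfl⟩ := n.eq_nat_or_neg
  · rw [sfac_natCast, show (n : ℤ) + 1 = ((n + 1 : ℕ) : ℤ) by push_cast; rfl, sfac_natCast,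
      bpoch_succ]
    simp
  · cases n with
    | zero => simpa [bpoch] using sfac_natCast (br := br) (δ := δ) z 1
    | succ n =>
      rw [show -((n + 1 : ℕ) : ℤ) + 1 = -(n : ℤ) by push_cast; ring, sfac_neg_natCast,
        sfac_neg_natCast, bpoch_succ']
      have h1 := h (-((n + 1 : ℕ) : ℤ))
      rw [show z - ((n + 1 : ℕ) : ℂ) * δ + δ = z - n * δ by push_cast; ring,
        show z - ((n + 1 : ℕ) : ℂ) * δ = z + ((-((n + 1 : ℕ) : ℤ) : ℤ) : ℂ) * δ by push_cast; ring,
        mul_inv, mul_right_comm, inv_mul_cancel₀ h1, one_mul]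

theorem sfac_add {z : ℂ} (h : ∀ a : ℤ, br (z + a * δ) ≠ 0) (a b : ℤ) :
    sfac br δ z (a + b) = sfac br δ z a * sfac br δ (z + a * δ) b := by
  have h' : ∀ c : ℤ, br (z + a * δ + c * δ) ≠ 0 := fun c => by
    convert h (a + c) using 2
    push_cast; ring
  have hstep : ∀ b : ℤ, sfac br δ z (a + (b + 1)) = sfac br δ z a * sfac br δ (z + a * δ) (b + 1)
      ↔ sfac br δ z (a + b) = sfac br δ z a * sfac br δ (z + a * δ) b := fun b => by
    rw [← add_assoc, sfac_add_one h, sfac_add_one h', ← mul_assoc,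
      show z + ((a + b : ℤ) : ℂ) * δ = z + a * δ + b * δ by push_cast; ring]
    exact mul_left_inj' (h' b)
  induction b using Int.induction_on with
  | zero => simp
  | succ b ih => exact (hstep b).mpr ih
  | pred b ih => exact (hstep _).mp (by simpa using ih)

theorem IsBracket.bpoch_neg (h : IsBracket br) (z : ℂ) (n : ℕ) :
    bpoch br δ (-z) n = (-1) ^ n * bpoch br δ (z + (1 - n) * δ) n := by
  rw [bpoch, ← Finset.prod_range_reflect, bpoch]
  conv_rhs => rw [← Finset.card_range n, ← Finset.prod_const, Finset.card_range,
    ← Finset.prod_mul_distrib]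
  refine Finset.prod_congr rfl fun a ha => ?_
  rw [Finset.mem_range] at ha
  rw [Nat.sub_sub, Nat.cast_sub (by omega), neg_one_mul, ← h.odd]
  congr 1
  push_cast; ring

theorem IsBracket.continuous_bpoch (h : IsBracket br) (n : ℕ) :
    Continuous fun z => bpoch br δ z n := by
  have := h.entire.continuous
  unfold bpoch
  fun_prop

theorem IsBracket.continuousAt_sfac_div (h : IsBracket br) {n : ℤ} {f g : ℂ → ℂ} {c : ℂ}
    (hf : ContinuousAt f c) (hg : ContinuousAt g c)
    (hn : if 0 ≤ n then sfac br δ (g c) n ≠ 0 else sfac br δ (f c) n ≠ 0) :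
    ContinuousAt (fun s => sfac br δ (f s) n / sfac br δ (g s) n) c := by
  have hb : ∀ (l : ℕ) {u : ℂ → ℂ}, ContinuousAt u c →
      ContinuousAt (fun s => bpoch br δ (u s) l) c := fun l u hu =>
    ((h.continuous_bpoch l).continuousAt (x := u c)).comp hu
  split_ifs at hn with h0
  · lift n to ℕ using h0
    simp only [sfac_natCast] at hn ⊢
    exact (hb n hf).div (hb n hg) hn
  · obtain ⟨l, rfl⟩ : ∃ l : ℕ, n = -(l : ℤ) := ⟨(-n).toNat, by omega⟩
    simp only [sfac_neg_natCast, inv_div_inv] at hn ⊢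
    exact (hb l (hg.sub continuousAt_const)).div (hb l (hf.sub continuousAt_const))
      (by simpa using hn)

end sfac

/-- The summand `Gterm` with the factors that come from the end points shifted by `s`. -/
noncomputable def GtermShift (br : ℂ → ℂ) (δ κ : ℂ) {m r : ℕ} (lam : Fin m → ℤ)
    (μ : Fin m → ℕ) (I : Finset (Fin r)) (x : Fin m → ℂ) (y : Fin r → ℂ) (s : ℂ) : ℂ :=
  (∏ i ∈ I, ∏ j ∈ Iᶜ,
      (br (y i - y j - δ) * br (y i - y j + δ - κ)) / (br (y i - y j) * br (y i - y j - κ)))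
    * (∏ i : Fin m, ∏ j : Fin m,
        (sfac br δ (x i - x j + δ) ((μ i : ℤ) - (μ j : ℤ))
            / sfac br δ (x i - x j + κ) ((μ i : ℤ) - (μ j : ℤ)))
          * ((sfac br δ (x i - x j + κ) (μ i : ℤ)
                * sfac br δ (x i - x j + s + κ) ((μ i : ℤ) - lam j))
              / (sfac br δ (x i - x j + δ) (μ i : ℤ)
                * sfac br δ (x i - x j + s + δ) ((μ i : ℤ) - lam j))))
    * ∏ i : Fin m,
        ((∏ j ∈ I,
            (br (x i - y j + (lam i : ℂ) * δ - κ - s) * br (x i - y j + ((μ i : ℂ) - 1) * δ + κ))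
              / (br (x i - y j + ((lam i : ℂ) - 1) * δ - s) * br (x i - y j + (μ i : ℂ) * δ)))
          * ∏ j ∈ Iᶜ,
            (br (x i - y j - δ) * br (x i - y j + (μ i : ℂ) * δ - κ))
              / (br (x i - y j - κ) * br (x i - y j + ((μ i : ℂ) - 1) * δ)))

section matching

variable {br : ℂ → ℂ} {δ κ s : ℂ} {m r : ℕ} {lam : Fin m → ℤ} {μ : Fin m → ℕ}
  {I : Finset (Fin r)} {x : Fin m → ℂ} {y : Fin r → ℂ}

theorem GtermShift_zero : GtermShift br δ κ lam μ I x y 0 = Gterm br δ κ lam μ I x y := by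
  simp only [GtermShift, Gterm, add_zero, sub_zero]

theorem bpoch_quotient_telescope {D : ℂ} (n : ℕ) (h0 : ∀ a : ℤ, br (D + a * δ) ≠ 0)
    (h1 : ∀ a : ℤ, br (D + a * δ - κ) ≠ 0) :
    bpoch br δ (D - δ) n * bpoch br δ (D + δ - κ) n / (bpoch br δ D n * bpoch br δ (D - κ) n)
      = br (D - δ) * br (D + n * δ - κ) / (br (D - κ) * br (D + (n - 1) * δ)) := by
  have e1 : bpoch br δ (D - δ) n * br (D + (n - 1) * δ) = br (D - δ) * bpoch br δ D n := by
    have := bpoch_succ (br := br) (δ := δ) (D - δ) n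
    rw [bpoch_succ', sub_add_cancel] at this
    rw [this]
    ring_nf
  have e2 : br (D - κ) * bpoch br δ (D + δ - κ) n = bpoch br δ (D - κ) n * br (D + n * δ - κ) := by
    have := bpoch_succ (br := br) (δ := δ) (D - κ) n
    rw [bpoch_succ', show D - κ + δ = D + δ - κ by ring] at this
    rw [this]
    ring_nf
  have n1 : bpoch br δ D n ≠ 0 := bpoch_ne_zero fun a => by simpa using h0 a
  have n2 : bpoch br δ (D - κ) n ≠ 0 := bpoch_ne_zero fun a => by
    convert h1 a using 2
    push_cast; ring
  have n3 : br (D - κ) ≠ 0 := by simpa using h1 0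
  have n4 : br (D + (n - 1) * δ) ≠ 0 := by simpa using h0 (n - 1)
  rw [div_eq_div_iff (mul_ne_zero n1 n2) (mul_ne_zero n3 n4)]
  linear_combination br (D - κ) * bpoch br δ (D + δ - κ) n * e1 + br (D - δ) * bpoch br δ D n * e2

theorem IsBracket.sfac_quotient_eq_bpoch (h : IsBracket br) {d : ℂ} {a b : ℕ}
    (h0 : a = b ∨ ∀ n : ℤ, br (d + n * δ) ≠ 0) (h1 : ∀ n : ℤ, br (d + κ + n * δ) ≠ 0) :
    sfac br δ (d + δ) ((a : ℤ) - b) / sfac br δ (d + κ) ((a : ℤ) - b)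
        * (sfac br δ (d + κ) a / sfac br δ (d + δ) a)
      = bpoch br δ (-d + (1 - a) * δ - κ) b / bpoch br δ (-d - a * δ) b := by
  have hκ : sfac br δ (d + κ) a
      = sfac br δ (d + κ) ((a : ℤ) - b) * bpoch br δ (d + κ + (a - b) * δ) b := by
    have := sfac_add h1 ((a : ℤ) - b) b
    rw [sub_add_cancel] at this
    rw [this, sfac_natCast]
    push_cast; rfl
  have hδ : sfac br δ (d + δ) ((a : ℤ) - b) ≠ 0 ∧ sfac br δ (d + δ) a
      = sfac br δ (d + δ) ((a : ℤ) - b) * bpoch br δ (d + δ + (a - b) * δ) b := by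
    rcases h0 with rfl | h0
    · simp [sfac_natCast]
    · have h0' : ∀ n : ℤ, br (d + δ + n * δ) ≠ 0 := fun n => by
        convert h0 (n + 1) using 2
        push_cast; ring
      have := sfac_add h0' ((a : ℤ) - b) b
      rw [sub_add_cancel] at this
      refine ⟨sfac_ne_zero h0' _, ?_⟩
      rw [this, sfac_natCast]
      push_cast; rfl
  have hκ' : sfac br δ (d + κ) ((a : ℤ) - b) ≠ 0 := sfac_ne_zero h1 _
  rw [show -d + (1 - a) * δ - κ = -(d + κ + (a - 1) * δ) by ring,
    show -d - a * δ = -(d + a * δ) by ring, h.bpoch_neg, h.bpoch_neg,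
    mul_div_mul_left _ _ (pow_ne_zero b (by norm_num)), hκ, hδ.2,
    show d + κ + (a - 1) * δ + (1 - b) * δ = d + κ + (a - b) * δ by ring,
    show d + a * δ + (1 - b) * δ = d + δ + (a - b) * δ by ring, div_mul_div_comm,
    mul_left_comm, mul_div_mul_left _ _ hκ', mul_div_mul_left _ _ hδ.1]

theorem sfac_sub_quotient {d : ℂ} {n : ℕ} {l : ℤ} (h0 : ∀ a : ℤ, br (d + a * δ) ≠ 0)
    (h1 : ∀ a : ℤ, br (d + κ + a * δ) ≠ 0) :
    sfac br δ (d + κ) (n - l) / sfac br δ (d + δ) (n - l)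
      = sfac br δ (d + κ) (-l) / sfac br δ (d + δ) (-l)
        * (bpoch br δ (d - l * δ + κ) n / bpoch br δ (d - l * δ + δ) n) := by
  have h0' : ∀ a : ℤ, br (d + δ + a * δ) ≠ 0 := fun a => by
    convert h0 (a + 1) using 2
    push_cast; ring
  rw [show (n : ℤ) - l = -l + n by ring, sfac_add h1, sfac_add h0', sfac_natCast, sfac_natCast,
    mul_div_mul_comm]
  push_cast
  ring_nf

theorem prod_univ_eq_prod_of_one {α : Type*} [Fintype α] (J : Finset α) {f : α → ℂ}
    (h : ∀ j ∉ J, f j = 1) : ∏ j, f j = ∏ j ∈ J, f j :=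
  (Finset.prod_subset (Finset.subset_univ J) fun j _ hj => h j hj).symm

/-- The constant relating `multiTerm` to `GtermShift`. -/
noncomputable def shiftConst (br : ℂ → ℂ) (δ κ : ℂ) {m : ℕ} (lam : Fin m → ℤ) (x : Fin m → ℂ)
    (s : ℂ) : ℂ :=
  ∏ i, ∏ j, sfac br δ (x i - x j + s + κ) (-lam j) / sfac br δ (x i - x j + s + δ) (-lam j)

theorem IsBracket.multiTerm_start_start (h : IsBracket br) (hx : StringGeneric br δ κ x)
    (hs : ∀ i j, ∀ a : ℤ, br (x i - x j + s + a * δ) ≠ 0)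
    (hs' : ∀ i j, ∀ a : ℤ, br (x i - x j + s + κ + a * δ) ≠ 0) :
    shiftConst br δ κ lam x s * multiTerm br δ κ x (fun i => x i + lam i * δ - κ - s) μ
      = ∏ i : Fin m, ∏ j : Fin m,
        (sfac br δ (x i - x j + δ) ((μ i : ℤ) - (μ j : ℤ))
            / sfac br δ (x i - x j + κ) ((μ i : ℤ) - (μ j : ℤ)))
          * ((sfac br δ (x i - x j + κ) (μ i : ℤ)
                * sfac br δ (x i - x j + s + κ) ((μ i : ℤ) - lam j))
              / (sfac br δ (x i - x j + δ) (μ i : ℤ)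
                * sfac br δ (x i - x j + s + δ) ((μ i : ℤ) - lam j))) := by
  have e1 : multiTerm br δ κ x (fun i => x i + lam i * δ - κ - s) μ
      = (∏ i, ∏ j, bpoch br δ (x i - x j + s - lam j * δ + κ) (μ i)
          / bpoch br δ (x i - x j + s - lam j * δ + δ) (μ i))
        * ∏ i, ∏ j, bpoch br δ (-(x i - x j) + (1 - μ i) * δ - κ) (μ j)
          / bpoch br δ (-(x i - x j) - μ i * δ) (μ j) := by
    rw [Finset.prod_comm (f := fun i j => bpoch br δ (-(x i - x j) + (1 - μ i) * δ - κ) (μ j)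
          / bpoch br δ (-(x i - x j) - μ i * δ) (μ j)), multiTerm]
    simp only [← Finset.prod_mul_distrib]
    refine Finset.prod_congr rfl fun i _ => Finset.prod_congr rfl fun j _ => ?_
    rw [div_mul_div_comm, mul_comm (bpoch br δ (x i - x j - μ j * δ) (μ i)), neg_sub,
      show x i - (x j + lam j * δ - κ - s) = x i - x j + s - lam j * δ + κ by ring,
      show x i - x j + s - lam j * δ + κ + δ - κ = x i - x j + s - lam j * δ + δ by ring]
  rw [e1, shiftConst]
  simp only [← Finset.prod_mul_distrib]
  refine Finset.prod_congr rfl fun i _ => Finset.prod_congr rfl fun j _ => ?_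
  rw [← h.sfac_quotient_eq_bpoch, mul_div_mul_comm, sfac_sub_quotient (hs i j) (hs' i j)]
  · ring
  · by_cases hij : i = j
    · left; rw [hij]
    · right
      intro n
      simpa using hx.diff i j hij n 0
  · intro n
    by_cases hij : i = j
    · subst hij
      convert hx.const n 1 (by right; norm_num) using 2
      push_cast; ring
    · convert hx.diff i j hij n 1 using 2
      push_cast; ring

/-- The multiplicities of the starting points attached to `μ` and `I`. -/
def sumIndex (μ : Fin m → ℕ) (I : Finset (Fin r)) : Fin m ⊕ Fin r → ℕ :=
  Sum.elim μ fun j => if j ∈ I then 1 else 0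

theorem IsBracket.shiftConst_mul_multiTerm (h : IsBracket br)
    (hx : StringGeneric br δ κ (Sum.elim x y))
    (hs : ∀ i j, ∀ a : ℤ, br (x i - x j + s + a * δ) ≠ 0)
    (hs' : ∀ i j, ∀ a : ℤ, br (x i - x j + s + κ + a * δ) ≠ 0) :
    shiftConst br δ κ lam x s * multiTerm br δ κ (Sum.elim x y)
        (Sum.elim (fun i => x i + lam i * δ - κ - s) fun j => y j + δ) (sumIndex μ I)
      = GtermShift br δ κ lam μ I x y s := by
  have hxx : StringGeneric br δ κ x := ⟨hx.const, fun i j hij a b => by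
    simpa using hx.diff (Sum.inl i) (Sum.inl j) (by simpa using hij) a b⟩
  have hn1 : br (-δ) ≠ 0 := by simpa using hx.const (-1) 0 (by simp)
  have hn2 : br (-κ) ≠ 0 := by simpa using hx.const 0 (-1) (by simp)
  rw [multiTerm]
  simp only [Fintype.prod_sum_type, Finset.prod_mul_distrib (s := Finset.univ), Sum.elim_inl,
    Sum.elim_inr, sumIndex, GtermShift]
  have hxx' := h.multiTerm_start_start (lam := lam) (μ := μ) hxx hs hs'
  rw [multiTerm] at hxx'
  simp only [Finset.prod_mul_distrib (s := Finset.univ)] at hxx'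
  rw [← hxx']
  clear hxx'
  have hxy : (∏ i : Fin m, ∏ j : Fin r, bpoch br δ (x i - (y j + δ)) (μ i)
        * bpoch br δ (x i - y j + (1 - ((if j ∈ I then 1 else 0 : ℕ) : ℂ)) * δ - κ) (μ i)
        / (bpoch br δ (x i - y j - ((if j ∈ I then 1 else 0 : ℕ) : ℂ) * δ) (μ i)
          * bpoch br δ (x i - (y j + δ) + δ - κ) (μ i)))
      = ∏ i : Fin m, ∏ j ∈ Iᶜ, (br (x i - y j - δ) * br (x i - y j + (μ i : ℂ) * δ - κ))
              / (br (x i - y j - κ) * br (x i - y j + ((μ i : ℂ) - 1) * δ)) := by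
    refine Finset.prod_congr rfl fun i _ => ?_
    have g0 : ∀ j, ∀ a : ℤ, br (x i - y j + a * δ) ≠ 0 := fun j a => by
      simpa using hx.diff (Sum.inl i) (Sum.inr j) (by simp) a 0
    have g1 : ∀ j, ∀ a : ℤ, br (x i - y j + a * δ - κ) ≠ 0 := fun j a => by
      simpa [sub_eq_add_neg] using hx.diff (Sum.inl i) (Sum.inr j) (by simp) a (-1)
    rw [prod_univ_eq_prod_of_one Iᶜ]
    · refine Finset.prod_congr rfl fun j hj => ?_
      rw [← bpoch_quotient_telescope (μ i) (g0 j) (g1 j), if_neg (Finset.mem_compl.mp hj)]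
      simp only [Nat.cast_zero, sub_zero, one_mul, zero_mul]
      ring_nf
    · intro j hj
      rw [Finset.mem_compl, not_not] at hj
      rw [if_pos hj]
      simp only [Nat.cast_one, sub_self, zero_mul, add_zero, one_mul, ← sub_sub, sub_add_cancel]
      refine div_self (mul_ne_zero (bpoch_ne_zero fun a => ?_) (bpoch_ne_zero fun a => ?_))
      · convert g0 j (a - 1) using 2
        push_cast; ring
      · convert g1 j a using 2
        push_cast; ring
  have hyx : (∏ i : Fin r, ∏ j : Fin m, bpoch br δ (y i - (x j + lam j * δ - κ - s))
          (if i ∈ I then 1 else 0)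
        * bpoch br δ (y i - x j + (1 - (μ j : ℂ)) * δ - κ) (if i ∈ I then 1 else 0)
        / (bpoch br δ (y i - x j - μ j * δ) (if i ∈ I then 1 else 0)
          * bpoch br δ (y i - (x j + lam j * δ - κ - s) + δ - κ) (if i ∈ I then 1 else 0)))
      = ∏ i : Fin m, ∏ j ∈ I,
            (br (x i - y j + (lam i : ℂ) * δ - κ - s) * br (x i - y j + ((μ i : ℂ) - 1) * δ + κ))
              / (br (x i - y j + ((lam i : ℂ) - 1) * δ - s) * br (x i - y j + (μ i : ℂ) * δ)) := by
    rw [Finset.prod_comm]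
    refine Finset.prod_congr rfl fun i _ => ?_
    rw [prod_univ_eq_prod_of_one I]
    · refine Finset.prod_congr rfl fun j hj => ?_
      rw [if_pos hj]
      simp only [bpoch, Finset.prod_range_one, Nat.cast_zero, zero_mul, add_zero]
      rw [show y j - (x i + lam i * δ - κ - s) = -(x i - y j + lam i * δ - κ - s) by ring,
        show y j - x i + (1 - (μ i : ℂ)) * δ - κ = -(x i - y j + ((μ i : ℂ) - 1) * δ + κ) by ring,
        show y j - x i - μ i * δ = -(x i - y j + μ i * δ) by ring,
        show -(x i - y j + lam i * δ - κ - s) + δ - κ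
          = -(x i - y j + ((lam i : ℂ) - 1) * δ - s) by ring, h.odd, h.odd, h.odd, h.odd,
        neg_mul_neg, neg_mul_neg, mul_comm (br (x i - y j + μ i * δ))]
    · intro j hj
      simp [hj, bpoch]
  have hyy : (∏ i : Fin r, ∏ j : Fin r, bpoch br δ (y i - (y j + δ)) (if i ∈ I then 1 else 0)
        * bpoch br δ (y i - y j + (1 - ((if j ∈ I then 1 else 0 : ℕ) : ℂ)) * δ - κ)
          (if i ∈ I then 1 else 0)
        / (bpoch br δ (y i - y j - ((if j ∈ I then 1 else 0 : ℕ) : ℂ) * δ) (if i ∈ I then 1 else 0)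
          * bpoch br δ (y i - (y j + δ) + δ - κ) (if i ∈ I then 1 else 0)))
      = ∏ i ∈ I, ∏ j ∈ Iᶜ,
      (br (y i - y j - δ) * br (y i - y j + δ - κ)) / (br (y i - y j) * br (y i - y j - κ)) := by
    rw [prod_univ_eq_prod_of_one I fun i hi => by simp [hi, bpoch]]
    refine Finset.prod_congr rfl fun i hi => ?_
    rw [prod_univ_eq_prod_of_one Iᶜ]
    · refine Finset.prod_congr rfl fun j hj => ?_
      rw [if_pos hi, if_neg (Finset.mem_compl.mp hj)]
      simp only [bpoch, Finset.prod_range_one, Nat.cast_zero, zero_mul, add_zero, sub_zero, one_mul,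
        ← sub_sub, sub_add_cancel]
    · intro j hj
      rw [Finset.mem_compl, not_not] at hj
      rw [if_pos hi, if_pos hj]
      simp only [bpoch, Finset.prod_range_one, Nat.cast_zero, Nat.cast_one, sub_self, zero_mul,
        add_zero, one_mul, ← sub_sub, sub_add_cancel]
      by_cases hij : i = j
      · subst hij
        rw [sub_self, zero_sub, zero_sub]
        exact div_self (mul_ne_zero hn1 hn2)
      · have hd := hx.diff (Sum.inr i) (Sum.inr j) (by simpa using hij)
        refine div_self (mul_ne_zero ?_ ?_)
        · simpa [sub_eq_add_neg] using hd (-1) 0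
        · simpa [sub_eq_add_neg] using hd 0 (-1)
  rw [hxy, hyx, hyy]
  ring

end matching

section limits

variable {br : ℂ → ℂ} {δ κ : ℂ} {m r : ℕ} {lam : Fin m → ℤ} {μ : Fin m → ℕ}
  {I : Finset (Fin r)}

theorem IsBracket.continuousAt_GtermShift (h : IsBracket br) {κ σ : ℂ → ℂ} {x : ℂ → Fin m → ℂ}
    {y : ℂ → Fin r → ℂ} {c : ℂ} (hκ : ContinuousAt κ c) (hσ : ContinuousAt σ c) (hσc : σ c = 0)
    (hx : ∀ i, ContinuousAt (fun t => x t i) c) (hy : ∀ i, ContinuousAt (fun t => y t i) c)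
    (hD : GDenomNZ br δ (κ c) lam μ I (x c) (y c)) :
    ContinuousAt (fun t => GtermShift br δ (κ t) lam μ I (x t) (y t) (σ t)) c := by
  have hb : ∀ {u : ℂ → ℂ}, ContinuousAt u c → ContinuousAt (fun t => br (u t)) c := fun hu =>
    h.entire.continuous.continuousAt.comp hu
  obtain ⟨hyy, hxx, hxy, hxy'⟩ := hD
  unfold GtermShift
  refine ((tendsto_finsetProd _ fun i hi => tendsto_finsetProd _ fun j hj => ?_).mul
    (tendsto_finsetProd _ fun i _ => tendsto_finsetProd _ fun j _ => ?_)).mul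
    (tendsto_finsetProd _ fun i _ => (tendsto_finsetProd _ fun j hj => ?_).mul
      (tendsto_finsetProd _ fun j hj => ?_))
  · have := hy i
    have := hy j
    exact ((hb (by fun_prop)).mul (hb (by fun_prop))).div ((hb (by fun_prop)).mul (hb (by fun_prop)))
      (mul_ne_zero (hyy i hi j hj).1 (hyy i hi j hj).2)
  · have := hx i
    have := hx j
    obtain ⟨h1, h2, h3⟩ := hxx i j
    simp only [mul_div_mul_comm]
    refine (h.continuousAt_sfac_div (by fun_prop) (by fun_prop) ?_).mul
      ((h.continuousAt_sfac_div (by fun_prop) (by fun_prop) ?_).mul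
        (h.continuousAt_sfac_div (by fun_prop) (by fun_prop) ?_))
    · exact h1
    · rwa [if_pos (Int.natCast_nonneg _)]
    · simpa only [hσc, add_zero] using h3
  · have := hx i
    have := hy j
    refine ((hb (by fun_prop)).mul (hb (by fun_prop))).div
      ((hb (by fun_prop)).mul (hb (by fun_prop))) (mul_ne_zero ?_ (hxy i j hj).2)
    simpa only [hσc, sub_zero] using (hxy i j hj).1
  · have := hx i
    have := hy j
    exact ((hb (by fun_prop)).mul (hb (by fun_prop))).div ((hb (by fun_prop)).mul (hb (by fun_prop)))
      (mul_ne_zero (hxy' i j hj).1 (hxy' i j hj).2)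

theorem eq_of_eventually_cocountable {f g : ℂ → ℂ} {c : ℂ} (hf : ContinuousAt f c)
    (hg : ContinuousAt g c) (hfg : ∀ᶠ s in (cocountable : Filter ℂ), f s = g s) : f c = g c := by
  have hd : Dense {s | f s = g s} := by
    have := (show {s | f s = g s}ᶜ.Countable from mem_cocountable.mp hfg).dense_compl ℂ
    rwa [compl_compl] at this
  have : (𝓝[{s | f s = g s}] c).NeBot := mem_closure_iff_nhdsWithin_neBot.mp (hd c)
  exact tendsto_nhds_unique_of_eventuallyEq (l := 𝓝[{s | f s = g s}] c) (hf.tendsto.mono_left nhdsWithin_le_nhds)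
    (hg.tendsto.mono_left nhdsWithin_le_nhds) eventually_mem_nhdsWithin

variable {x : Fin m → ℂ} {y : Fin r → ℂ}

theorem StringGeneric.gDenomNZ (hx : StringGeneric br δ κ (Sum.elim x y)) :
    GDenomNZ br δ κ lam μ I x y := by
  have hκ : ∀ (i j : Fin m) (a : ℤ), br (x i - x j + κ + a * δ) ≠ 0 := fun i j a => by
    by_cases hij : i = j
    · subst hij
      convert hx.const a 1 (by right; norm_num) using 2
      push_cast; ring
    · convert hx.diff (.inl i) (.inl j) (by simpa) a 1 using 2
      simp; ring
  have hδ : ∀ (i j : Fin m), i ≠ j → ∀ a : ℤ, br (x i - x j + δ + a * δ) ≠ 0 := fun i j hij a => by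
    convert hx.diff (.inl i) (.inl j) (by simpa) (a + 1) 0 using 2
    simp; ring
  have hδ' : ∀ (i j : Fin m) (n : ℕ), sfac br δ (x i - x j + δ) n ≠ 0 := fun i j n => by
    by_cases hij : i = j
    · rw [sfac_natCast]
      refine bpoch_ne_zero fun a => ?_
      convert hx.const (a + 1) 0 (by left; omega) using 2
      rw [hij]; push_cast; ring
    · exact sfac_ne_zero (hδ i j hij) _
  have hxy : ∀ (i : Fin m) (j : Fin r) (a b : ℤ), br (x i - y j + a * δ + b * κ) ≠ 0 :=
    fun i j a b => hx.diff (.inl i) (.inr j) (by simp) a b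
  refine ⟨fun i hi j hj => ?_, fun i j => ⟨?_, hδ' i j _, ?_⟩, fun i j hj => ⟨?_, ?_⟩,
    fun i j hj => ⟨?_, ?_⟩⟩
  · have hij : i ≠ j := by
      rintro rfl
      exact Finset.mem_compl.mp hj hi
    constructor
    · simpa using hx.diff (.inr i) (.inr j) (by simpa) 0 0
    · simpa [sub_eq_add_neg] using hx.diff (.inr i) (.inr j) (by simpa) 0 (-1)
  · split_ifs with h0
    · exact sfac_ne_zero (hκ i j) _
    · exact sfac_ne_zero (hδ i j (by rintro rfl; simp at h0)) _
  · split_ifs with h0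
    · obtain ⟨n, hn⟩ := Int.eq_ofNat_of_zero_le h0
      rw [hn]
      exact hδ' i j n
    · exact sfac_ne_zero (hκ i j) _
  · simpa using hxy i j (lam i - 1) 0
  · simpa using hxy i j (μ i) 0
  · simpa [sub_eq_add_neg] using hxy i j 0 (-1)
  · simpa using hxy i j (μ i - 1) 0

theorem IsBracket.sfac_self_eq_zero (h : IsBracket br) {n : ℤ} (hn : n < 0) :
    sfac br δ δ n = 0 := by
  obtain ⟨l, rfl⟩ : ∃ l : ℕ, n = -((l + 1 : ℕ) : ℤ) := ⟨(-n).toNat - 1, by omega⟩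
  rw [sfac_neg_natCast, bpoch_succ,
    show δ - ((l + 1 : ℕ) : ℂ) * δ + l * δ = 0 by push_cast; ring, h.map_zero, mul_zero, inv_zero]

theorem IsBracket.Gterm_eq_zero (h : IsBracket br) {i : Fin m} (hi : (μ i : ℤ) < lam i) :
    Gterm br δ κ lam μ I x y = 0 := by
  refine mul_eq_zero_of_left (mul_eq_zero_of_right _ (Finset.prod_eq_zero (Finset.mem_univ i)
    (Finset.prod_eq_zero (Finset.mem_univ i) ?_))) _
  rw [sub_self (x i), zero_add δ, h.sfac_self_eq_zero (by omega : (μ i : ℤ) - lam i < 0), mul_zero,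
    div_zero, mul_zero]

theorem mem_GIdx {k : ℕ} {p : (Fin m → ℕ) × Finset (Fin r)} :
    p ∈ GIdx lam r k ↔ (∀ j, lam j ≤ (p.1 j : ℤ)) ∧ (∑ i, p.1 i) + p.2.card = k := by
  rw [GIdx, Finset.mem_filter, and_iff_right_iff_imp]
  rintro ⟨-, hk⟩
  rw [Finset.mem_product, Fintype.mem_piFinset]
  refine ⟨fun i => Finset.mem_range.mpr ?_, Finset.mem_univ _⟩
  have := Finset.single_le_sum (f := p.1) (fun _ _ => Nat.zero_le _) (Finset.mem_univ i)
  omega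

theorem IsBracket.sum_GIdx_zero (h : IsBracket br) (k : ℕ) :
    ∑ p ∈ GIdx (0 : Fin m → ℤ) r k, Gterm br δ κ lam p.1 p.2 x y
      = ∑ p ∈ GIdx lam r k, Gterm br δ κ lam p.1 p.2 x y := by
  refine (Finset.sum_subset (fun p hp => ?_) fun p hp hp' => ?_).symm
  · rw [mem_GIdx] at hp ⊢
    exact ⟨fun j => by simp, hp.2⟩
  · rw [mem_GIdx] at hp hp'
    have : ¬ ∀ j, lam j ≤ (p.1 j : ℤ) := fun hj => hp' ⟨hj, hp.2⟩
    push Not at this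
    obtain ⟨i, hi⟩ := this
    exact h.Gterm_eq_zero hi

theorem IsBracket.multiTerm_eq_zero (h : IsBracket br) {ι : Type*} [Fintype ι] {x e : ι → ℂ}
    {μ : ι → ℕ} {i : ι} (he : e i = x i + δ) (hi : 2 ≤ μ i) : multiTerm br δ κ x e μ = 0 := by
  have : bpoch br δ (x i - e i) (μ i) = 0 :=
    Finset.prod_eq_zero (Finset.mem_range.mpr hi) (by
      rw [he, show x i - (x i + δ) + ((1 : ℕ) : ℂ) * δ = 0 by push_cast; ring, h.map_zero])
  refine Finset.prod_eq_zero (Finset.mem_univ i) (Finset.prod_eq_zero (Finset.mem_univ i) ?_)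
  rw [this, zero_mul, zero_div]

theorem IsBracket.sum_multiTerm_sumElim (h : IsBracket br) {e : Fin m → ℂ} (k : ℕ) :
    ∑ μ ∈ Finset.piAntidiag Finset.univ k,
        multiTerm br δ κ (Sum.elim x y) (Sum.elim e fun j => y j + δ) μ
      = ∑ p ∈ GIdx (0 : Fin m → ℤ) r k,
        multiTerm br δ κ (Sum.elim x y) (Sum.elim e fun j => y j + δ) (sumIndex p.1 p.2) := by
  symm
  refine Finset.sum_of_injOn (fun p : (Fin m → ℕ) × Finset (Fin r) => sumIndex p.1 p.2) ?_ ?_ ?_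
    fun _ _ => rfl
  · rintro ⟨μ, I⟩ - ⟨μ', I'⟩ - hp
    have h1 : μ = μ' := funext fun i => congrFun hp (.inl i)
    have h2 : I = I' := by
      ext j
      have := congrFun hp (.inr j)
      simp only [sumIndex, Sum.elim_inr] at this
      split_ifs at this <;> simp_all
    rw [h1, h2]
  · intro p hp
    rw [Finset.mem_coe, mem_GIdx] at hp
    simp [Finset.mem_piAntidiag, sumIndex, hp.2]
  · intro μ hμ hμ'
    have : ∃ j, 2 ≤ μ (.inr j) := by
      by_contra! hj
      refine hμ' ⟨(fun i => μ (.inl i), Finset.univ.filter fun j => μ (.inr j) = 1), ?_, ?_⟩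
      · rw [Finset.mem_coe, mem_GIdx]
        refine ⟨fun j => by simp, ?_⟩
        rw [Finset.mem_piAntidiag, Fintype.sum_sum_type] at hμ
        rw [← hμ.1, Finset.card_filter]
        congr 1
        refine Finset.sum_congr rfl fun j _ => ?_
        have := hj j
        split_ifs <;> omega
      · funext i
        rcases i with i | j
        · rfl
        · have := hj j
          simp only [sumIndex, Sum.elim_inr, Finset.mem_filter, Finset.mem_univ, true_and]
          split_ifs <;> omega
    obtain ⟨j, hj⟩ := this
    exact h.multiTerm_eq_zero (i := .inr j) (by simp) hj

end limits

section generic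

variable {br : ℂ → ℂ} {δ κ s : ℂ} {m r : ℕ} {lam : Fin m → ℤ} {x : Fin m → ℂ} {y : Fin r → ℂ}

theorem StringGeneric.reflect (h : IsBracket br) (hx : StringGeneric br δ κ (Sum.elim x y))
    (hs : ∀ i j, ∀ a b : ℤ, br (s + (y j - x i) + a * δ + b * κ) ≠ 0) :
    StringGeneric br δ κ (Sum.elim (fun i => -x i - lam i * δ + κ + s) fun j => -y j - δ) := by
  refine ⟨hx.const, ?_⟩
  rintro (i | i) (j | j) hij a b
  · convert hx.diff (.inl j) (.inl i) hij.symm (a - lam i + lam j) b using 2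
    simp; ring
  · convert hs i j (a - lam i + 1) (b + 1) using 2
    simp; ring
  · rw [← neg_ne_zero, ← h.odd]
    convert hs j i (-a - lam j + 1) (-b + 1) using 2
    simp; ring
  · convert hx.diff (.inr j) (.inr i) hij.symm a b using 2
    simp; ring

theorem StringGeneric.endGeneric (h : IsBracket br) (hx : StringGeneric br δ κ (Sum.elim x y))
    (hs : ∀ i j, ∀ a b : ℤ,
      br (s + (Sum.elim x y i - Sum.elim x y j) + a * δ + b * κ) ≠ 0) :
    EndGeneric br δ κ (Sum.elim x y)
      (Sum.elim (fun i => x i + lam i * δ - κ - s) fun j => y j + δ) := by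
  refine ⟨?_, ?_, ?_⟩
  · rintro i (j | j) a
    · convert hs i (.inl j) (a - lam j) 0 using 2
      simp; ring
    · by_cases hij : i = .inr j
      · subst hij
        convert hx.const (a - 1) (-1) (by right; norm_num) using 2
        simp; ring
      · convert hx.diff i (.inr j) hij (a - 1) (-1) using 2
        simp; ring
  · rintro i (j | j) hij a
    · convert hs i (.inl j) (a - lam j) 1 using 2
      simp; ring
    · convert hx.diff i (.inr j) hij (a - 1) 0 using 2
      simp; ring
  · rintro (i | i) (j | j) hij a
    · convert hx.diff (.inl i) (.inl j) hij (a + lam i - lam j) 0 using 2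
      simp; ring
    · rw [← neg_ne_zero, ← h.odd]
      convert hs (.inr j) (.inl i) (-a - lam i + 1) 1 using 2
      simp; ring
    · convert hs (.inr i) (.inl j) (a - lam j + 1) 1 using 2
      simp; ring
    · convert hx.diff (.inr i) (.inr j) hij a 0 using 2
      simp

theorem shiftConst_eq_mul_reflect (hs : ∀ i j, ∀ a b : ℤ,
      br (s + (x i - x j) + a * δ + b * κ) ≠ 0) :
    shiftConst br δ κ lam x s
      = (∏ i, ∏ j, sfac br δ (x i - x j + s + κ) (lam i - lam j)
          / sfac br δ (x i - x j + s + δ) (lam i - lam j))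
        * shiftConst br δ κ lam (fun i => -x i - lam i * δ + κ + s) s := by
  rw [shiftConst, shiftConst, Finset.prod_comm (f := fun i j => sfac br δ
      (-x i - lam i * δ + κ + s - (-x j - lam j * δ + κ + s) + s + κ) (-lam j) / _)]
  simp only [← Finset.prod_mul_distrib]
  refine Finset.prod_congr rfl fun i _ => Finset.prod_congr rfl fun j _ => ?_
  have hκ : ∀ a : ℤ, br (x i - x j + s + κ + a * δ) ≠ 0 := fun a => by
    convert hs i j a 1 using 2
    push_cast; ring
  have hδ : ∀ a : ℤ, br (x i - x j + s + δ + a * δ) ≠ 0 := fun a => by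
    convert hs i j (a + 1) 0 using 2
    push_cast; ring
  rw [show -lam j = (lam i - lam j) + -lam i by ring, sfac_add hκ, sfac_add hδ, mul_div_mul_comm]
  push_cast
  congr 3 <;> ring

theorem IsBracket.sum_GtermShift_eq (h : IsBracket br) (hx : StringGeneric br δ κ (Sum.elim x y))
    (hs : ∀ i j, ∀ a b : ℤ,
      br (s + (Sum.elim x y i - Sum.elim x y j) + a * δ + b * κ) ≠ 0) (k : ℕ) :
    ∑ p ∈ GIdx (0 : Fin m → ℤ) r k, GtermShift br δ κ lam p.1 p.2 x y s
      = (∏ i, ∏ j, sfac br δ (x i - x j + s + κ) (lam i - lam j)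
          / sfac br δ (x i - x j + s + δ) (lam i - lam j))
        * ∑ p ∈ GIdx (0 : Fin m → ℤ) r k, GtermShift br δ κ lam p.1 p.2
            (fun i => -x i - lam i * δ + κ + s) (fun j => -y j - δ) s := by
  have hs0 : ∀ (i j : Fin m) (a b : ℤ), br (s + (x i - x j) + a * δ + b * κ) ≠ 0 := fun i j =>
    hs (.inl i) (.inl j)
  have hx' := hx.reflect (lam := lam) h (s := s) fun i j => hs (.inr j) (.inl i)
  have key := h.sum_multiTerm_eq hx (hx.endGeneric (lam := lam) h hs) k
  have e1 : (fun i => -Sum.elim (fun i => x i + lam i * δ - κ - s) (fun j => y j + δ) i)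
      = Sum.elim (fun i => -x i - lam i * δ + κ + s) (fun j => -y j - δ) := by
    funext i
    rcases i with i | i <;> simp only [Sum.elim_inl, Sum.elim_inr] <;> ring
  have e2 : (fun i => -Sum.elim x y i)
      = Sum.elim (fun i => -x i - lam i * δ + κ + s + lam i * δ - κ - s) (fun j => -y j - δ + δ) := by
    funext i
    rcases i with i | i <;> simp only [Sum.elim_inl, Sum.elim_inr] <;> ring
  rw [e1, e2, h.sum_multiTerm_sumElim, h.sum_multiTerm_sumElim] at key
  have l1 : ∀ p ∈ GIdx (0 : Fin m → ℤ) r k, GtermShift br δ κ lam p.1 p.2 x y s = _ := fun p _ =>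
    (h.shiftConst_mul_multiTerm hx (fun i j a => ?_) fun i j a => ?_).symm
  have l2 : ∀ p ∈ GIdx (0 : Fin m → ℤ) r k, GtermShift br δ κ lam p.1 p.2
      (fun i => -x i - lam i * δ + κ + s) (fun j => -y j - δ) s = _ := fun p _ =>
    (h.shiftConst_mul_multiTerm hx' (fun i j a => ?_) fun i j a => ?_).symm
  · rw [Finset.sum_congr rfl l1, Finset.sum_congr rfl l2, ← Finset.mul_sum, ← Finset.mul_sum,
      ← mul_assoc, ← shiftConst_eq_mul_reflect hs0, key]
  · convert hs0 j i (a - lam i + lam j) 0 using 2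
    push_cast; ring
  · convert hs0 j i (a - lam i + lam j) 1 using 2
    push_cast; ring
  · convert hs0 i j a 0 using 2
    push_cast; ring
  · convert hs0 i j a 1 using 2
    push_cast; ring

theorem IsBracket.eventually_shift_ne_zero (h : IsBracket br) {ι : Type*} [Countable ι]
    (z : ι → ℂ) :
    ∀ᶠ s in (cocountable : Filter ℂ), ∀ i j, ∀ a b : ℤ,
      br (s + (z i - z j) + a * δ + b * κ) ≠ 0 := by
  simp only [eventually_countable_forall]
  intro i j a b
  filter_upwards [h.eventually_cocountable one_ne_zero (z i - z j + a * δ + b * κ)] with s hs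
  convert hs using 2
  ring

/-- The transformation of the sums of `Gterm` at generic points. -/
theorem IsBracket.sum_Gterm_eq (h : IsBracket br) (hx : StringGeneric br δ κ (Sum.elim x y))
    (k : ℕ) :
    ∑ p ∈ GIdx lam r k, Gterm br δ κ lam p.1 p.2 x y
      = (∏ i, ∏ j, sfac br δ (x i - x j + κ) (lam i - lam j)
          / sfac br δ (x i - x j + δ) (lam i - lam j))
        * ∑ p ∈ GIdx lam r k, Gterm br δ κ lam p.1 p.2
            (fun i => -x i - lam i * δ + κ) (fun j => -y j - δ) := by
  have hx' := hx.reflect (lam := lam) h (s := 0) fun i j a b => by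
    simpa using hx.diff (.inr j) (.inl i) (by simp) a b
  have key := eq_of_eventually_cocountable (c := 0)
    (f := fun s => ∑ p ∈ GIdx (0 : Fin m → ℤ) r k, GtermShift br δ κ lam p.1 p.2 x y s)
    (g := fun s => (∏ i, ∏ j, sfac br δ (x i - x j + s + κ) (lam i - lam j)
          / sfac br δ (x i - x j + s + δ) (lam i - lam j))
        * ∑ p ∈ GIdx (0 : Fin m → ℤ) r k, GtermShift br δ κ lam p.1 p.2
            (fun i => -x i - lam i * δ + κ + s) (fun j => -y j - δ) s) ?_ ?_ ?_
  · simpa only [GtermShift_zero, add_zero, h.sum_GIdx_zero] using key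
  · refine tendsto_finsetSum _ fun p _ => ?_
    exact h.continuousAt_GtermShift (κ := fun _ => κ) (σ := fun s => s) (x := fun _ => x)
      (y := fun _ => y) (by fun_prop) (by fun_prop) rfl (by fun_prop) (by fun_prop) hx.gDenomNZ
  · refine Tendsto.mul (tendsto_finsetProd _ fun i _ => tendsto_finsetProd _ fun j _ => ?_)
      (tendsto_finsetSum _ fun p _ => ?_)
    · refine h.continuousAt_sfac_div (by fun_prop) (by fun_prop) ?_
      by_cases hij : i = j
      · simp [hij]
      · rw [add_zero]
        split_ifs
        · refine sfac_ne_zero (fun a => ?_) _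
          convert hx.diff (.inl i) (.inl j) (by simpa) (a + 1) 0 using 2
          simp; ring
        · refine sfac_ne_zero (fun a => ?_) _
          convert hx.diff (.inl i) (.inl j) (by simpa) a 1 using 2
          simp; ring
    · exact h.continuousAt_GtermShift (κ := fun _ => κ) (σ := fun s => s)
        (x := fun s i => -x i - lam i * δ + κ + s) (y := fun _ j => -y j - δ) (by fun_prop)
        (by fun_prop) rfl (by fun_prop) (by fun_prop) hx'.gDenomNZ
  · filter_upwards [h.eventually_shift_ne_zero (δ := δ) (κ := κ) (Sum.elim x y)] with s hs
    exact h.sum_GtermShift_eq hx hs k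

theorem IsBracket.eventually_stringGeneric (h : IsBracket br)
    (hδ : ∀ n : ℕ, 1 ≤ n → br (n * δ) ≠ 0) {ι : Type*} [Countable ι] (z : ι → ℂ) (v : ι → ℕ)
    (hv : Function.Injective v) :
    ∀ᶠ s in (cocountable : Filter ℂ),
      StringGeneric br δ (κ + s * Complex.I) (fun i => z i + s * v i) := by
  have hc : ∀ᶠ s in (cocountable : Filter ℂ), ∀ a b : ℤ, a ≠ 0 ∨ b ≠ 0 →
      br (a * δ + b * (κ + s * Complex.I)) ≠ 0 := by
    simp only [eventually_countable_forall]
    intro a b hab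
    by_cases hb : b = 0
    · subst hb
      refine Eventually.of_forall fun s => ?_
      obtain ⟨n, rfl | rfl⟩ := a.eq_nat_or_neg
      · simpa using hδ n (by simp at hab; omega)
      · simpa [h.odd] using hδ n (by simp at hab; omega)
    · have hb' : (b : ℂ) * Complex.I ≠ 0 := mul_ne_zero (by exact_mod_cast hb) Complex.I_ne_zero
      filter_upwards [h.eventually_cocountable hb' (a * δ + b * κ)] with s hs
      convert hs using 2
      ring
  have hd : ∀ᶠ s in (cocountable : Filter ℂ), ∀ i j, i ≠ j → ∀ a b : ℤ,
      br (z i + s * v i - (z j + s * v j) + a * δ + b * (κ + s * Complex.I)) ≠ 0 := by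
    simp only [eventually_countable_forall]
    intro i j hij a b
    have hij' : (v i : ℂ) - v j + b * Complex.I ≠ 0 := fun e => by
      have := congrArg Complex.re e
      simp [sub_eq_zero] at this
      exact hij (hv (by exact_mod_cast this))
    filter_upwards [h.eventually_cocountable hij' (z i - z j + a * δ + b * κ)] with s hs
    convert hs using 2
    ring
  filter_upwards [hc, hd] with s h1 h2
  exact ⟨h1, h2⟩

theorem IsBracket.continuousAt_Gterm (h : IsBracket br) {μ : Fin m → ℕ} {I : Finset (Fin r)}
    {κ : ℂ → ℂ} {x : ℂ → Fin m → ℂ}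
    {y : ℂ → Fin r → ℂ} {c : ℂ} (hκ : ContinuousAt κ c)
    (hx : ∀ i, ContinuousAt (fun t => x t i) c) (hy : ∀ i, ContinuousAt (fun t => y t i) c)
    (hD : GDenomNZ br δ (κ c) lam μ I (x c) (y c)) :
    ContinuousAt (fun t => Gterm br δ (κ t) lam μ I (x t) (y t)) c := by
  simpa only [GtermShift_zero] using
    h.continuousAt_GtermShift hκ (σ := fun _ => 0) continuousAt_const rfl hx hy hD

end generic

/-- Scalar identity underlying the commutation of the two
deformed families: `Σ G(x; y) = ∏_{i,j} ([x_i-x_j+κ]_{λ_i-λ_j}/[x_i-x_j+δ]_{λ_i-λ_j})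
· Σ G(x̂; ŷ)` with `x̂_j = -x_j - λ_jδ + κ` and `ŷ_j = -y_j - δ`. -/
theorem Gsum_transformation
    (br : ℂ → ℂ) (hodd : ∀ z : ℂ, br (-z) = -br z)
    (hent : Differentiable ℂ br) (hnz : br ≠ 0)
    (hW : ∀ a b c d : ℂ,
      br (a + b) * br (a - b) * br (c + d) * br (c - d)
        + br (a + d) * br (a - d) * br (b + c) * br (b - c)
        = br (a + c) * br (a - c) * br (b + d) * br (b - d))
    (δ κ : ℂ)
    (hδ : ∀ n : ℕ, 1 ≤ n → br ((n : ℂ) * δ) ≠ 0)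
    (hκ : ∀ n : ℕ, 1 ≤ n → br ((n : ℂ) * κ) ≠ 0)
    (m r k : ℕ) (lam : Fin m → ℤ)
    (x : Fin m → ℂ) (y : Fin r → ℂ)
    (hpre : ∀ i j : Fin m,
      if (0 : ℤ) ≤ lam i - lam j then sfac br δ (x i - x j + δ) (lam i - lam j) ≠ 0
      else sfac br δ (x i - x j + κ) (lam i - lam j) ≠ 0)
    (h1 : ∀ p ∈ GIdx lam r k, GDenomNZ br δ κ lam p.1 p.2 x y)
    (h2 : ∀ p ∈ GIdx lam r k, GDenomNZ br δ κ lam p.1 p.2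
      (fun i => -x i - (lam i : ℂ) * δ + κ) (fun j => -y j - δ)) :
    ∑ p ∈ GIdx lam r k, Gterm br δ κ lam p.1 p.2 x y
      = (∏ i : Fin m, ∏ j : Fin m,
          sfac br δ (x i - x j + κ) (lam i - lam j)
            / sfac br δ (x i - x j + δ) (lam i - lam j))
        * ∑ p ∈ GIdx lam r k, Gterm br δ κ lam p.1 p.2
            (fun i => -x i - (lam i : ℂ) * δ + κ) (fun j => -y j - δ) := by
  have h : IsBracket br := ⟨hodd, hent, hnz, hW⟩
  let v : Fin m ⊕ Fin r → ℕ := fun i => (finSumFinEquiv i : ℕ)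
  have hv : Function.Injective v := Fin.val_injective.comp finSumFinEquiv.injective
  let K : ℂ → ℂ := fun s => κ + s * Complex.I
  let X : ℂ → Fin m → ℂ := fun s i => x i + s * v (.inl i)
  let Y : ℂ → Fin r → ℂ := fun s j => y j + s * v (.inr j)
  have hK0 : K 0 = κ := by simp [K]
  have hX0 : X 0 = x := by simp [X]
  have hY0 : Y 0 = y := by simp [Y]
  have hK : ContinuousAt K 0 := by fun_prop
  have hX : ∀ i, ContinuousAt (fun s => X s i) 0 := fun i => by fun_prop
  have hY : ∀ j, ContinuousAt (fun s => Y s j) 0 := fun j => by fun_prop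
  have key := eq_of_eventually_cocountable (c := 0)
    (f := fun s => ∑ p ∈ GIdx lam r k, Gterm br δ (K s) lam p.1 p.2 (X s) (Y s))
    (g := fun s => (∏ i, ∏ j, sfac br δ (X s i - X s j + K s) (lam i - lam j)
          / sfac br δ (X s i - X s j + δ) (lam i - lam j))
        * ∑ p ∈ GIdx lam r k, Gterm br δ (K s) lam p.1 p.2
            (fun i => -X s i - lam i * δ + K s) (fun j => -Y s j - δ)) ?_ ?_ ?_
  · simpa only [hK0, hX0, hY0] using key
  · exact tendsto_finsetSum _ fun p hp =>
      h.continuousAt_Gterm hK hX hY (by simpa only [hK0, hX0, hY0] using h1 p hp)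
  · refine Tendsto.mul (tendsto_finsetProd _ fun i _ => tendsto_finsetProd _ fun j _ => ?_)
      (tendsto_finsetSum _ fun p hp => ?_)
    · exact h.continuousAt_sfac_div (((hX i).sub (hX j)).add hK)
        (((hX i).sub (hX j)).add continuousAt_const) (by simpa only [hK0, hX0] using hpre i j)
    · exact h.continuousAt_Gterm (x := fun s i => -X s i - lam i * δ + K s)
        (y := fun s j => -Y s j - δ) hK (fun i => ((hX i).neg.sub continuousAt_const).add hK)
        (fun j => (hY j).neg.sub continuousAt_const)
        (by simpa only [hK0, hX0, hY0] using h2 p hp)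
  · filter_upwards [h.eventually_stringGeneric (κ := κ) hδ (Sum.elim x y) v hv] with s hs
    refine h.sum_Gterm_eq ?_ k
    convert hs using 1
    funext i
    rcases i with i | i <;> rfl
end

section
/- Gauge form of the coefficients at κ = δ: let F(x; y) := (∏_{1≤i<j≤m} [x_i−x_j] · ∏_{1≤i<j≤r} [y_i−y_j]) / ∏_{1≤i≤m, 1≤j≤r} [x_i−y_j−δ]. Then for every μ ∈ ℤ_{≥0}^m, every I ⊆ {1,…,r}, and every (x, y) ∈ ℂ^m × ℂ^r at which F(x; y) ≠ 0 and all bracket values occurring in denominators of C_{μ,I}(x; y; δ, δ) and of F(x+δμ; y−δ1_I) are nonzero, one has C_{μ,I}(x; y; δ, δ) = (−1)^{|I|} · F(x+δμ; y−δ1_I) / F(x; y). -/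
open Finset

/-- The coefficient `C_{μ,I}(x; y; a, b)`. -/
noncomputable def Coef (br : ℂ → ℂ) (a b : ℂ) {m r : ℕ} (μ : Fin m → ℕ)
    (I : Finset (Fin r)) (x : Fin m → ℂ) (y : Fin r → ℂ) : ℂ :=
  (-1 : ℂ) ^ I.card
    * (∏ i : Fin m, ∏ j : Fin m,
        if i < j then br (x i - x j + ((μ i : ℂ) - (μ j : ℂ)) * a) / br (x i - x j) else 1)
    * (∏ i ∈ I, ∏ j ∈ Iᶜ, br (y i - y j - a) / br (y i - y j))
    * (∏ i : Fin m, ∏ j : Fin m,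
        sfac br a (x i - x j + b) (μ i : ℤ) / sfac br a (x i - x j + a) (μ i : ℤ))
    * ∏ i : Fin m,
        ((∏ j ∈ I, br (x i - y j - b) / br (x i - y j + (μ i : ℂ) * a))
          * ∏ j ∈ Iᶜ, br (x i - y j - a) / br (x i - y j + ((μ i : ℂ) - 1) * a))

/-- Index set of the sums: pairs `(μ, I)` with `μ ∈ ℤ_{≥0}^m`, `I ⊆ {1,…,r}`, `|μ|+|I| = k`. -/
def idxSet (m r k : ℕ) : Finset ((Fin m → ℕ) × Finset (Fin r)) :=
  ((Fintype.piFinset fun _ : Fin m => Finset.range (k + 1)) ×ˢ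
      (Finset.univ : Finset (Finset (Fin r)))).filter
    fun p => (∑ i, p.1 i) + p.2.card = k

def xshift (c : ℂ) {m : ℕ} (μ : Fin m → ℕ) (x : Fin m → ℂ) : Fin m → ℂ :=
  fun i => x i + c * (μ i : ℂ)

def xshiftI (c : ℂ) {m : ℕ} (I : Finset (Fin m)) (x : Fin m → ℂ) : Fin m → ℂ :=
  fun i => x i + c * (if i ∈ I then 1 else 0)

def yshift (c : ℂ) {r : ℕ} (I : Finset (Fin r)) (y : Fin r → ℂ) : Fin r → ℂ :=
  fun j => y j - c * (if j ∈ I then 1 else 0)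

def yshiftMu (c : ℂ) {r : ℕ} (μ : Fin r → ℕ) (y : Fin r → ℂ) : Fin r → ℂ :=
  fun j => y j - c * (μ j : ℂ)

/-- The deformed elliptic Ruijsenaars operator `H_{m,r}^{(k)}`. -/
noncomputable def Hop (br : ℂ → ℂ) (δ κ : ℂ) (m r k : ℕ)
    (F : (Fin m → ℂ) → (Fin r → ℂ) → ℂ) (x : Fin m → ℂ) (y : Fin r → ℂ) : ℂ :=
  ∑ p ∈ idxSet m r k, Coef br δ κ p.1 p.2 x y * F (xshift δ p.1 x) (yshift κ p.2 y)

/-- The operator `D_{m,r}^{(k)}`. -/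
noncomputable def Dop (br : ℂ → ℂ) (δ κ : ℂ) (m r k : ℕ)
    (F : (Fin m → ℂ) → (Fin r → ℂ) → ℂ) (x : Fin m → ℂ) (y : Fin r → ℂ) : ℂ :=
  ∑ p ∈ idxSet r m k, Coef br (-κ) (-δ) p.1 p.2 y x * F (xshiftI δ p.2 x) (yshiftMu κ p.1 y)

/-- The operator `Ĥ_{m,r}^{(k)}`. -/
noncomputable def Hhat (br : ℂ → ℂ) (δ κ : ℂ) (m r k : ℕ)
    (F : (Fin m → ℂ) → (Fin r → ℂ) → ℂ) (x : Fin m → ℂ) (y : Fin r → ℂ) : ℂ :=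
  ∑ p ∈ idxSet m r k,
    Coef br (-δ) (-κ) p.1 p.2 (fun i => x i - δ) (fun j => y j + κ)
      * F (xshift (-δ) p.1 x) (yshift (-κ) p.2 y)

/-- The operator `D̂_{m,r}^{(k)}`. -/
noncomputable def Dhat (br : ℂ → ℂ) (δ κ : ℂ) (m r k : ℕ)
    (F : (Fin m → ℂ) → (Fin r → ℂ) → ℂ) (x : Fin m → ℂ) (y : Fin r → ℂ) : ℂ :=
  ∑ p ∈ idxSet r m k,
    Coef br κ δ p.1 p.2 (fun j => y j + κ) (fun i => x i - δ)
      * F (xshiftI (-δ) p.2 x) (yshiftMu (-κ) p.1 y)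

/-- Nonvanishing of all bracket values occurring in denominators of `C_{μ,I}(x; y; a, b)`. -/
def CDenomNZ (br : ℂ → ℂ) (a : ℂ) {m r : ℕ} (μ : Fin m → ℕ)
    (I : Finset (Fin r)) (x : Fin m → ℂ) (y : Fin r → ℂ) : Prop :=
  (∀ i j : Fin m, i < j → br (x i - x j) ≠ 0)
    ∧ (∀ i ∈ I, ∀ j ∈ Iᶜ, br (y i - y j) ≠ 0)
    ∧ (∀ i j : Fin m, sfac br a (x i - x j + a) (μ i : ℤ) ≠ 0)
    ∧ (∀ i : Fin m, ∀ j ∈ I, br (x i - y j + (μ i : ℂ) * a) ≠ 0)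
    ∧ (∀ i : Fin m, ∀ j ∈ Iᶜ, br (x i - y j + ((μ i : ℂ) - 1) * a) ≠ 0)

/-- The gauge function
`F(x; y) = (∏_{i<j}[x_i-x_j] ∏_{i<j}[y_i-y_j]) / ∏_{i,j}[x_i-y_j-δ]`. -/
noncomputable def gaugeF (br : ℂ → ℂ) (δ : ℂ) {m r : ℕ}
    (x : Fin m → ℂ) (y : Fin r → ℂ) : ℂ :=
  ((∏ i : Fin m, ∏ j : Fin m, if i < j then br (x i - x j) else 1)
      * ∏ i : Fin r, ∏ j : Fin r, if i < j then br (y i - y j) else 1)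
    / ∏ i : Fin m, ∏ j : Fin r, br (x i - y j - δ)

/-- A double product over all ordered pairs that is trivial on the diagonal is a product over
the pairs `i < j` of the contributions of `(i, j)` and `(j, i)`. -/
theorem prod_prod_eq_prod_lt_mul_swap {ι M : Type*} [Fintype ι] [LinearOrder ι] [CommMonoid M]
    (f : ι → ι → M) (hf : ∀ i, f i i = 1) :
    ∏ i, ∏ j, f i j = ∏ i, ∏ j, if i < j then f i j * f j i else 1 := by
  have hsplit : ∀ i j, f i j = (if i < j then f i j else 1) * (if j < i then f i j else 1) := by
    intro i j
    rcases lt_trichotomy i j with h | h | h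
    · simp [h, h.not_gt]
    · simp [h, hf]
    · simp [h, h.not_gt]
  have hmerge : ∀ i j, (if i < j then f i j * f j i else 1)
      = (if i < j then f i j else 1) * (if i < j then f j i else 1) := by
    intro i j
    split_ifs <;> simp
  simp_rw [hmerge, prod_mul_distrib]
  rw [prod_comm (f := fun i j => if i < j then f j i else 1)]
  simp_rw [← prod_mul_distrib, ← hsplit]

/-- The ratio of the shifted and unshifted `y`-Vandermonde products. -/
theorem prod_yshift_ratio (br : ℂ → ℂ) (hodd : ∀ z : ℂ, br (-z) = -br z) (δ : ℂ) {r : ℕ}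
    (I : Finset (Fin r)) (y : Fin r → ℂ)
    (hy : ∀ i j : Fin r, i < j → br (y i - y j) ≠ 0) :
    ∏ i ∈ I, ∏ j ∈ Iᶜ, br (y i - y j - δ) / br (y i - y j)
      = ∏ i, ∏ j, if i < j
          then br (yshift δ I y i - yshift δ I y j) / br (y i - y j) else 1 := by
  have hfull : ∏ i ∈ I, ∏ j ∈ Iᶜ, br (y i - y j - δ) / br (y i - y j)
      = ∏ i, ∏ j, if i ∈ I ∧ j ∉ I then br (y i - y j - δ) / br (y i - y j) else 1 := by
    rw [← prod_subset (subset_univ I)]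
    · refine prod_congr rfl fun i hi => ?_
      rw [← prod_subset (subset_univ Iᶜ)]
      · refine prod_congr rfl fun j hj => ?_
        rw [if_pos ⟨hi, mem_compl.mp hj⟩]
      · intro j _ hj
        rw [if_neg fun h => hj (mem_compl.mpr h.2)]
    · intro i _ hi
      simp [hi]
  rw [hfull, prod_prod_eq_prod_lt_mul_swap _ fun i => if_neg fun h => h.2 h.1]
  refine prod_congr rfl fun i _ => prod_congr rfl fun j _ => ?_
  by_cases hij : i < j
  · rw [if_pos hij, if_pos hij]
    by_cases hi : i ∈ I <;> by_cases hj : j ∈ I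
    · simp [yshift, hi, hj, hy i j hij]
    · simp [yshift, hi, hj, sub_right_comm]
    · have hnum : br (y j - y i - δ) = -br (y i - (y j - δ)) := by
        rw [← hodd]
        congr 1
        ring
      have hden : br (y j - y i) = -br (y i - y j) := by
        rw [← hodd, neg_sub]
      simp [yshift, hi, hj, hnum, hden]
    · simp [yshift, hi, hj, hy i j hij]
  · rw [if_neg hij, if_neg hij]

/-- Gauge form of the coefficients at `κ = δ`:
`C_{μ,I}(x; y; δ, δ) = (-1)^{|I|} F(x+δμ; y-δ1_I) / F(x; y)`
at every admissible point. -/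
theorem coef_gauge_form
    (br : ℂ → ℂ) (hodd : ∀ z : ℂ, br (-z) = -br z)
    (hent : Differentiable ℂ br) (hnz : br ≠ 0)
    (hW : ∀ a b c d : ℂ,
      br (a + b) * br (a - b) * br (c + d) * br (c - d)
        + br (a + d) * br (a - d) * br (b + c) * br (b - c)
        = br (a + c) * br (a - c) * br (b + d) * br (b - d))
    (δ : ℂ)
    (hδ : ∀ n : ℕ, 1 ≤ n → br ((n : ℂ) * δ) ≠ 0)
    (m r : ℕ) (μ : Fin m → ℕ) (I : Finset (Fin r))
    (x : Fin m → ℂ) (y : Fin r → ℂ)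
    (hF : gaugeF br δ x y ≠ 0)
    (hC : CDenomNZ br δ μ I x y)
    (hFs : ∀ (i : Fin m) (j : Fin r),
      br (xshift δ μ x i - yshift δ I y j - δ) ≠ 0) :
    Coef br δ δ μ I x y
      = (-1 : ℂ) ^ I.card
          * gaugeF br δ (xshift δ μ x) (yshift δ I y) / gaugeF br δ x y := by
  obtain ⟨-, -, hs, -, -⟩ := hC
  have hN := (div_ne_zero_iff.mp hF).1
  have hVy := (mul_ne_zero_iff.mp hN).2
  have hy : ∀ i j : Fin r, i < j → br (y i - y j) ≠ 0 := by
    intro i j hij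
    have h := prod_ne_zero_iff.mp (prod_ne_zero_iff.mp hVy i (mem_univ i)) j (mem_univ j)
    rwa [if_pos hij] at h
  have hX : (∏ i : Fin m, ∏ j : Fin m,
        if i < j then br (x i - x j + ((μ i : ℂ) - (μ j : ℂ)) * δ) / br (x i - x j) else 1)
      = (∏ i : Fin m, ∏ j : Fin m, if i < j then br (xshift δ μ x i - xshift δ μ x j) else 1)
        / ∏ i : Fin m, ∏ j : Fin m, if i < j then br (x i - x j) else 1 := by
    simp_rw [← prod_div_distrib]
    refine prod_congr rfl fun i _ => prod_congr rfl fun j _ => ?_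
    have harg : xshift δ μ x i - xshift δ μ x j = x i - x j + ((μ i : ℂ) - (μ j : ℂ)) * δ := by
      simp only [xshift]
      ring
    rw [harg]
    split_ifs <;> simp
  have hY : (∏ i ∈ I, ∏ j ∈ Iᶜ, br (y i - y j - δ) / br (y i - y j))
      = (∏ i : Fin r, ∏ j : Fin r, if i < j then br (yshift δ I y i - yshift δ I y j) else 1)
        / ∏ i : Fin r, ∏ j : Fin r, if i < j then br (y i - y j) else 1 := by
    rw [prod_yshift_ratio br hodd δ I y hy]
    simp_rw [← prod_div_distrib]
    refine prod_congr rfl fun i _ => prod_congr rfl fun j _ => ?_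
    split_ifs <;> simp
  have hS : (∏ i : Fin m, ∏ j : Fin m,
      sfac br δ (x i - x j + δ) (μ i : ℤ) / sfac br δ (x i - x j + δ) (μ i : ℤ)) = 1 :=
    prod_eq_one fun i _ => prod_eq_one fun j _ => div_self (hs i j)
  have hXY : (∏ i : Fin m,
        ((∏ j ∈ I, br (x i - y j - δ) / br (x i - y j + (μ i : ℂ) * δ))
          * ∏ j ∈ Iᶜ, br (x i - y j - δ) / br (x i - y j + ((μ i : ℂ) - 1) * δ)))
      = (∏ i : Fin m, ∏ j : Fin r, br (x i - y j - δ))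
        / ∏ i : Fin m, ∏ j : Fin r, br (xshift δ μ x i - yshift δ I y j - δ) := by
    simp_rw [← prod_div_distrib]
    refine prod_congr rfl fun i _ => ?_
    rw [← prod_mul_prod_compl I]
    congr 1
    · refine prod_congr rfl fun j hj => ?_
      have harg : xshift δ μ x i - yshift δ I y j - δ = x i - y j + (μ i : ℂ) * δ := by
        simp only [xshift, yshift, if_pos hj]
        ring
      rw [harg]
    · refine prod_congr rfl fun j hj => ?_
      have harg : xshift δ μ x i - yshift δ I y j - δ = x i - y j + ((μ i : ℂ) - 1) * δ := by
        simp only [xshift, yshift, if_neg (mem_compl.mp hj)]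
        ring
      rw [harg]
  rw [Coef, hX, hY, hS, hXY, gaugeF, gaugeF]
  field_simp
end
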